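/- arXiv:1605.01287 — 2 statements merged into one kernel-verified Lean document; each statement's English description precedes it below -/
import Mathlib

section
/- Fix a weight w=(w₁,w₂) with w₁ ≥ w₂ > 0 and w₁+w₂ = 1. For any u ∈ Q with |u| > 1 one has B_w(u, 2^{−1/w₂}·r(u)) ⊆ Δ(u) ⊆ B_w(u, 2^{1/w₂}·r(u)), where Δ(u) is the set of x ∈ ℝ² having u as a w-best approximate. -/
open Filter

/-- The `w`-weighted quasi-norm `‖(y₁,y₂)‖_w = max(|y₁|^{1/w₁}, |y₂|^{1/w₂})`. -/
noncomputable def wnorm (w₁ w₂ : ℝ) (y : ℝ × ℝ) : ℝ :=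
  max (|y.1| ^ (1 / w₁)) (|y.2| ^ (1 / w₂))

/-- `A(x, v) = ‖q·x − p‖_w` for `v = (p₁, p₂, q)`. -/
noncomputable def Afun (w₁ w₂ : ℝ) (x : ℝ × ℝ) (v : ℤ × ℤ × ℤ) : ℝ :=
  wnorm w₁ w₂ ((v.2.2 : ℝ) * x.1 - (v.1 : ℝ), (v.2.2 : ℝ) * x.2 - (v.2.1 : ℝ))

/-- `Q` is the set of triples `(p₁, p₂, q) ∈ ℤ² × ℕ` with `gcd(p₁, p₂, q) = 1`. -/
def Qset : Set (ℤ × ℤ × ℤ) :=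
  {v | 0 < v.2.2 ∧ Int.gcd (Int.gcd v.1 v.2.1) v.2.2 = 1}

/-- `û = p/q ∈ ℚ² ⊆ ℝ²` for `u = (p, q)`. -/
noncomputable def uhat (u : ℤ × ℤ × ℤ) : ℝ × ℝ :=
  ((u.1 : ℝ) / (u.2.2 : ℝ), (u.2.1 : ℝ) / (u.2.2 : ℝ))

/-- `(p, q) ∈ ℤ² × ℕ` is a `w`-best approximate of `x`: its weighted error beats
every vector of strictly smaller denominator, and is minimal among vectors with the
same denominator. -/
def IsBest (w₁ w₂ : ℝ) (x : ℝ × ℝ) (u : ℤ × ℤ × ℤ) : Prop :=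
  0 < u.2.2 ∧
  (∀ v : ℤ × ℤ × ℤ, 0 < v.2.2 → v.2.2 < u.2.2 →
    Afun w₁ w₂ x u < Afun w₁ w₂ x v) ∧
  (∀ p : ℤ × ℤ, Afun w₁ w₂ x u ≤ Afun w₁ w₂ x (p.1, p.2, u.2.2))

/-- `r(u)`: the minimal value of `A(û, v)` over `v ∈ Q` with `v ≠ u`. -/
noncomputable def rfun (w₁ w₂ : ℝ) (u : ℤ × ℤ × ℤ) : ℝ :=
  sInf {a : ℝ | ∃ v ∈ Qset, v ≠ u ∧ a = Afun w₁ w₂ (uhat u) v}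

/-- The quasi-norm is monotone in the absolute values of the coordinates. -/
theorem wnorm_mono {w₁ w₂ : ℝ} (hw₁ : 0 < w₁) (hw₂ : 0 < w₂) {y z : ℝ × ℝ}
    (h₁ : |y.1| ≤ |z.1|) (h₂ : |y.2| ≤ |z.2|) : wnorm w₁ w₂ y ≤ wnorm w₁ w₂ z := by
  unfold wnorm
  gcongr

theorem wnorm_nonneg (w₁ w₂ : ℝ) (y : ℝ × ℝ) : 0 ≤ wnorm w₁ w₂ y :=
  le_max_of_le_left (Real.rpow_nonneg (abs_nonneg _) _)

theorem abs_fst_le_wnorm_rpow {w₁ : ℝ} (hw₁ : 0 < w₁) (w₂ : ℝ) (y : ℝ × ℝ) :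
    |y.1| ≤ wnorm w₁ w₂ y ^ w₁ := by
  rw [← Real.rpow_inv_le_iff_of_pos (abs_nonneg _) (wnorm_nonneg _ _ _) hw₁, ← one_div]
  exact le_max_left _ _

theorem abs_snd_le_wnorm_rpow (w₁ : ℝ) {w₂ : ℝ} (hw₂ : 0 < w₂) (y : ℝ × ℝ) :
    |y.2| ≤ wnorm w₁ w₂ y ^ w₂ := by
  rw [← Real.rpow_inv_le_iff_of_pos (abs_nonneg _) (wnorm_nonneg _ _ _) hw₂, ← one_div]
  exact le_max_right _ _

theorem abs_add_rpow_le {s t : ℝ} (hs : 0 ≤ s) (hst : s ≤ t) (a b : ℝ) :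
    |a + b| ^ s ≤ 2 ^ t * max (|a| ^ s) (|b| ^ s) := by
  have h : |a + b| ≤ 2 * max |a| |b| := by
    linarith [abs_add_le a b, le_max_left |a| |b|, le_max_right |a| |b|]
  calc |a + b| ^ s ≤ (2 * max |a| |b|) ^ s := by gcongr
    _ = 2 ^ s * max |a| |b| ^ s := Real.mul_rpow (by norm_num) (by positivity)
    _ = 2 ^ s * max (|a| ^ s) (|b| ^ s) := by
        congr 1
        rcases le_total |a| |b| with hab | hab
        · rw [max_eq_right hab, max_eq_right (by gcongr)]
        · rw [max_eq_left hab, max_eq_left (by gcongr)]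
    _ ≤ 2 ^ t * max (|a| ^ s) (|b| ^ s) := by gcongr; norm_num

/-- The quasi-triangle inequality. -/
theorem wnorm_add_le {w₁ w₂ : ℝ} (hw₂ : 0 < w₂) (hw : w₂ ≤ w₁) (y z : ℝ × ℝ) :
    wnorm w₁ w₂ (y + z) ≤ (2 : ℝ) ^ (1 / w₂) * max (wnorm w₁ w₂ y) (wnorm w₁ w₂ z) := by
  have hw₁ : 0 < w₁ := hw₂.trans_le hw
  refine max_le ?_ ?_
  · refine (abs_add_rpow_le (t := 1 / w₂) (by positivity) (by gcongr) y.1 z.1).trans ?_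
    unfold wnorm
    gcongr <;> exact le_max_left _ _
  · refine (abs_add_rpow_le (t := 1 / w₂) (by positivity) le_rfl y.2 z.2).trans ?_
    unfold wnorm
    gcongr <;> exact le_max_right _ _

theorem lt_rpow_mul_of_lt_abs_rpow {N R c a b w w₂ : ℝ} (hw₂ : 0 < w₂) (hw : w₂ ≤ w)
    (hN : 0 ≤ N) (hR : 0 ≤ R) (hc : 0 ≤ c) (hc' : 2 * c ≤ 1) (ha : |a| ≤ N ^ w)
    (hb : |b| ≤ R ^ w) (h : N < |c * a + b| ^ (1 / w)) : N < (2 : ℝ) ^ (1 / w₂) * R := by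
  have hw₀ : 0 < w := hw₂.trans_le hw
  have h₁ : N ^ w < |c * a + b| := by
    rwa [← Real.lt_rpow_inv_iff_of_pos hN (abs_nonneg _) hw₀, ← one_div]
  have h₂ : |c * a + b| ≤ c * N ^ w + R ^ w := by
    refine (abs_add_le _ _).trans ?_
    rw [abs_mul, abs_of_nonneg hc]
    gcongr
  have h₃ : N ^ w < 2 * R ^ w := by nlinarith [Real.rpow_nonneg hN w]
  have h₄ : N < (2 : ℝ) ^ (1 / w) * R := by
    rw [← Real.rpow_lt_rpow_iff hN (by positivity) hw₀, Real.mul_rpow (by positivity) hR,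
      ← Real.rpow_mul (by norm_num), one_div_mul_cancel hw₀.ne', Real.rpow_one]
    exact h₃
  refine h₄.trans_le ?_
  gcongr
  norm_num

/-- If `y` is shorter than `c • y + z` with `0 ≤ c ≤ 1/2`, then it is controlled by `z`. -/
theorem wnorm_lt_of_lt_wnorm_add {w₁ w₂ : ℝ} (hw₂ : 0 < w₂) (hw : w₂ ≤ w₁) {y z : ℝ × ℝ}
    {c : ℝ} (hc : 0 ≤ c) (hc' : 2 * c ≤ 1) (h : wnorm w₁ w₂ y < wnorm w₁ w₂ (c • y + z)) :
    wnorm w₁ w₂ y < (2 : ℝ) ^ (1 / w₂) * wnorm w₁ w₂ z := by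
  have hw₁ : 0 < w₁ := hw₂.trans_le hw
  rcases lt_max_iff.1 h with h | h
  · exact lt_rpow_mul_of_lt_abs_rpow hw₂ hw (wnorm_nonneg _ _ _) (wnorm_nonneg _ _ _) hc hc'
      (abs_fst_le_wnorm_rpow hw₁ w₂ y) (abs_fst_le_wnorm_rpow hw₁ w₂ z) h
  · exact lt_rpow_mul_of_lt_abs_rpow hw₂ le_rfl (wnorm_nonneg _ _ _) (wnorm_nonneg _ _ _) hc hc'
      (abs_snd_le_wnorm_rpow w₁ hw₂ y) (abs_snd_le_wnorm_rpow w₁ hw₂ z) h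

theorem one_le_wnorm_of_ne_zero {w₁ w₂ : ℝ} (hw₁ : 0 < w₁) (hw₂ : 0 < w₂) {m n : ℤ}
    (h : m ≠ 0 ∨ n ≠ 0) : 1 ≤ wnorm w₁ w₂ ((m : ℝ), (n : ℝ)) := by
  rcases h with h | h
  · exact le_max_of_le_left (Real.one_le_rpow (by dsimp only; exact_mod_cast Int.one_le_abs h)
      (by positivity))
  · exact le_max_of_le_right (Real.one_le_rpow (by dsimp only; exact_mod_cast Int.one_le_abs h)
      (by positivity))

/-- The vector `q • x - p` for `v = (p, q)`. -/
noncomputable def displacement (x : ℝ × ℝ) (v : ℤ × ℤ × ℤ) : ℝ × ℝ :=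
  ((v.2.2 : ℝ) * x.1 - (v.1 : ℝ), (v.2.2 : ℝ) * x.2 - (v.2.1 : ℝ))

theorem displacement_eq_add {u : ℤ × ℤ × ℤ} (hu : u.2.2 ≠ 0) (x : ℝ × ℝ) (v : ℤ × ℤ × ℤ) :
    displacement x v =
      ((v.2.2 : ℝ) / u.2.2) • displacement x u + displacement (uhat u) v := by
  have : (u.2.2 : ℝ) ≠ 0 := by exact_mod_cast hu
  ext <;> simp [displacement, uhat] <;> field_simp <;> ring

/-- The infimum defining `r(u)` is attained. -/
theorem exists_Afun_uhat_eq_rfun {w₁ w₂ : ℝ} (hw₁ : 0 < w₁) (hw₂ : 0 < w₂) {u : ℤ × ℤ × ℤ}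
    (hu1 : 1 < u.2.2) : ∃ v ∈ Qset, v ≠ u ∧ rfun w₁ w₂ u = Afun w₁ w₂ (uhat u) v := by
  have hq : (0 : ℝ) < u.2.2 := by exact_mod_cast (by omega : 0 < u.2.2)
  set S := {a : ℝ | ∃ v ∈ Qset, v ≠ u ∧ a = Afun w₁ w₂ (uhat u) v}
  have hne : S.Nonempty := ⟨_, (0, 0, 1), by simp [Qset], by rintro rfl; simp at hu1, rfl⟩
  let g : ℕ × ℕ → ℝ := fun n => wnorm w₁ w₂ ((n.1 : ℝ) / u.2.2, (n.2 : ℝ) / u.2.2)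
  have hg : Monotone g := by
    intro m n hmn
    have h₁ : (m.1 : ℝ) ≤ n.1 := by exact_mod_cast hmn.1
    have h₂ : (m.2 : ℝ) ≤ n.2 := by exact_mod_cast hmn.2
    apply wnorm_mono hw₁ hw₂ <;> simp only [abs_div, Nat.abs_cast] <;> gcongr
  have hS : S ⊆ g '' Set.univ := by
    rintro _ ⟨v, -, -, rfl⟩
    refine ⟨((v.2.2 * u.1 - u.2.2 * v.1).natAbs, (v.2.2 * u.2.1 - u.2.2 * v.2.1).natAbs),
      trivial, ?_⟩
    have key (a b : ℤ) : |((v.2.2 * a - u.2.2 * b).natAbs : ℝ) / u.2.2| =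
        |(v.2.2 : ℝ) * ((a : ℝ) / u.2.2) - b| := by
      rw [Nat.cast_natAbs, Int.cast_abs, abs_div, abs_abs, ← abs_div]
      congr 1
      push_cast
      field_simp
    simp only [g, Afun, wnorm, uhat, key]
  have hwf : S.IsWF :=
    ((Set.IsPWO.image_of_monotone (Set.isPWO_of_wellQuasiOrderedLE _) hg).mono hS).isWF
  have hleast : IsLeast S (hwf.min hne) := ⟨hwf.min_mem hne, fun a ha => hwf.min_le hne ha⟩
  have hr : rfun w₁ w₂ u = hwf.min hne := hleast.csInf_eq
  rw [hr]
  exact hwf.min_mem hne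

theorem rfun_le_Afun_of_mem {w₁ w₂ : ℝ} {u v : ℤ × ℤ × ℤ} (hv : v ∈ Qset) (hvu : v ≠ u) :
    rfun w₁ w₂ u ≤ Afun w₁ w₂ (uhat u) v :=
  csInf_le ⟨0, by rintro _ ⟨v, -, -, rfl⟩; exact wnorm_nonneg _ _ _⟩ ⟨v, hv, hvu, rfl⟩

/-- A vector of positive denominator is a positive multiple of an element of `Q`. -/
theorem exists_Qset_smul_eq {v : ℤ × ℤ × ℤ} (hv : 0 < v.2.2) :
    ∃ g : ℤ, 0 < g ∧ ∃ w ∈ Qset, v = g • w := by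
  obtain ⟨a, b, q⟩ := v
  simp only at hv
  have hpos : 0 < Int.gcd (Int.gcd a b) q := Int.gcd_pos_of_ne_zero_right _ hv.ne'
  set d := Int.gcd (Int.gcd a b) q with hd
  have hdab : (d : ℤ) ∣ (Int.gcd a b : ℤ) := Int.gcd_dvd_left ..
  obtain ⟨a', ha⟩ := hdab.trans (Int.gcd_dvd_left ..)
  obtain ⟨b', hb⟩ := hdab.trans (Int.gcd_dvd_right ..)
  obtain ⟨q', hq⟩ : (d : ℤ) ∣ q := Int.gcd_dvd_right ..
  have hd0 : (0 : ℤ) < d := by exact_mod_cast hpos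
  refine ⟨d, hd0, (a', b', q'), ⟨?_, ?_⟩, ?_⟩
  · rw [hq] at hv
    exact pos_of_mul_pos_right hv hd0.le
  · have h : d = d * Int.gcd (Int.gcd a' b') q' := by
      conv_lhs => rw [hd, ha, hb, hq, Int.gcd_mul_left]
      rw [Int.natAbs_natCast, Nat.cast_mul, Int.gcd_mul_left, Int.natAbs_natCast]
    exact Nat.eq_of_mul_eq_mul_left hpos (by simpa using h.symm)
  · simp [ha, hb, hq]

theorem rfun_le_Afun {w₁ w₂ : ℝ} (hw₁ : 0 < w₁) (hw₂ : 0 < w₂) {u v : ℤ × ℤ × ℤ}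
    (hv : 0 < v.2.2) (hle : v.2.2 ≤ u.2.2) (hvu : v ≠ u) :
    rfun w₁ w₂ u ≤ Afun w₁ w₂ (uhat u) v := by
  obtain ⟨g, hg, w, hw, rfl⟩ := exists_Qset_smul_eq hv
  have hwu : w ≠ u := by
    rintro rfl
    have hw0 := hw.1
    have : g = 1 := by
      simp only [Prod.smul_snd, smul_eq_mul] at hle
      nlinarith
    simp [this] at hvu
  refine (rfun_le_Afun_of_mem hw hwu).trans ?_
  have hg1 : (1 : ℝ) ≤ |(g : ℝ)| := by exact_mod_cast Int.one_le_abs hg.ne'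
  apply wnorm_mono hw₁ hw₂ <;>
  · simp only [Prod.smul_snd, Prod.smul_fst, smul_eq_mul, Int.cast_mul, mul_assoc, ← mul_sub,
      abs_mul (g : ℝ)]
    exact le_mul_of_one_le_left (abs_nonneg _) hg1

theorem Afun_lt_of_Afun_lt_rfun {w₁ w₂ : ℝ} (hw₂ : 0 < w₂) (hw : w₂ ≤ w₁)
    {u v : ℤ × ℤ × ℤ} {x : ℝ × ℝ} (hx : Afun w₁ w₂ x u < (2 : ℝ) ^ (-(1 / w₂)) * rfun w₁ w₂ u)
    (hv : 0 < v.2.2) (hle : v.2.2 ≤ u.2.2) (hvu : v ≠ u) : Afun w₁ w₂ x u < Afun w₁ w₂ x v := by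
  have hw₁ : 0 < w₁ := hw₂.trans_le hw
  have hu0 : 0 < u.2.2 := hv.trans_le hle
  have hu0' : (0 : ℝ) < u.2.2 := by exact_mod_cast hu0
  have hv0' : (0 : ℝ) < v.2.2 := by exact_mod_cast hv
  have hc : |(v.2.2 : ℝ) / u.2.2| ≤ 1 := by
    rw [abs_of_nonneg (by positivity), div_le_one hu0']
    exact_mod_cast hle
  rw [Real.rpow_neg (by norm_num), inv_mul_eq_div, lt_div_iff₀' (by positivity)] at hx
  set c := (v.2.2 : ℝ) / u.2.2
  have hsplit : displacement (uhat u) v = displacement x v + (-c) • displacement x u := by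
    rw [displacement_eq_add hu0.ne' x v, neg_smul]
    abel
  have hscale : wnorm w₁ w₂ ((-c) • displacement x u) ≤ Afun w₁ w₂ x u := by
    apply wnorm_mono hw₁ hw₂ <;>
    · simp only [Prod.smul_fst, Prod.smul_snd, smul_eq_mul, abs_mul, abs_neg]
      exact mul_le_of_le_one_left (abs_nonneg _) hc
  have h := (rfun_le_Afun hw₁ hw₂ hv hle hvu).trans
    ((congrArg (wnorm w₁ w₂) hsplit).trans_le (wnorm_add_le hw₂ hw _ _))
  have h' := lt_of_mul_lt_mul_left (hx.trans_le h) (by positivity)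
  exact (lt_max_iff.1 h').resolve_right hscale.not_gt

theorem IsBest.Afun_le_one {w₁ w₂ : ℝ} (hw₁ : 0 < w₁) (hw₂ : 0 < w₂) {x : ℝ × ℝ}
    {u : ℤ × ℤ × ℤ} (h : IsBest w₁ w₂ x u) : Afun w₁ w₂ x u ≤ 1 := by
  refine (h.2.2 (round (u.2.2 * x.1), round (u.2.2 * x.2))).trans (max_le ?_ ?_) <;>
  · refine Real.rpow_le_one (abs_nonneg _) ((abs_sub_round _).trans ?_) (by positivity)
    norm_num

theorem IsBest.Afun_lt_of_two_mul_le {w₁ w₂ : ℝ} (hw₂ : 0 < w₂) (hw : w₂ ≤ w₁) {x : ℝ × ℝ}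
    {u v : ℤ × ℤ × ℤ} (h : IsBest w₁ w₂ x u) (hv : 0 < v.2.2) (hle : 2 * v.2.2 ≤ u.2.2) :
    Afun w₁ w₂ x u < (2 : ℝ) ^ (1 / w₂) * Afun w₁ w₂ (uhat u) v := by
  have hu0 : (0 : ℝ) < u.2.2 := by exact_mod_cast h.1
  have hv0 : (0 : ℝ) < v.2.2 := by exact_mod_cast hv
  have hlt : Afun w₁ w₂ x u < wnorm w₁ w₂ (displacement x v) := h.2.1 v hv (by omega)
  rw [displacement_eq_add h.1.ne' x v] at hlt
  refine wnorm_lt_of_lt_wnorm_add hw₂ hw (by positivity) ?_ hlt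
  rw [← mul_div_assoc, div_le_one hu0]
  exact_mod_cast hle

theorem Afun_uhat_sub_smul {w₁ w₂ : ℝ} {u : ℤ × ℤ × ℤ} (hu : u.2.2 ≠ 0) (v : ℤ × ℤ × ℤ)
    (k : ℤ) : Afun w₁ w₂ (uhat u) (v - k • u) = Afun w₁ w₂ (uhat u) v := by
  have : (u.2.2 : ℝ) ≠ 0 := by exact_mod_cast hu
  unfold Afun uhat
  congr 2 <;> simp <;> field_simp <;> ring

theorem Afun_neg (w₁ w₂ : ℝ) (x : ℝ × ℝ) (v : ℤ × ℤ × ℤ) :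
    Afun w₁ w₂ x (-v) = Afun w₁ w₂ x v := by
  have key (q y p : ℝ) : |-q * y - -p| = |q * y - p| := by rw [← abs_neg]; ring_nf
  simp [Afun, wnorm, key, -neg_mul, -sub_neg_eq_add]

theorem eq_of_mem_Qset_of_eq_smul {u v : ℤ × ℤ × ℤ} (hv : v ∈ Qset) (hu : 0 < u.2.2) {k : ℤ}
    (h : v = k • u) : v = u := by
  subst h
  have hk : 0 < k := pos_of_mul_pos_left (by simpa using hv.1) hu.le
  have hdvd : k ∣ ((Int.gcd (Int.gcd (k * u.1) (k * u.2.1)) (k * u.2.2) : ℕ) : ℤ) :=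
    Int.dvd_coe_gcd (Int.dvd_coe_gcd (dvd_mul_right ..) (dvd_mul_right ..)) (dvd_mul_right ..)
  have h1 : Int.gcd (Int.gcd (k * u.1) (k * u.2.1)) (k * u.2.2) = 1 := hv.2
  rw [h1] at hdvd
  have : k = 1 := Int.eq_one_of_dvd_one hk.le (by simpa using hdvd)
  simp [this]

theorem IsBest.Afun_lt {w₁ w₂ : ℝ} (hw₂ : 0 < w₂) (hw : w₂ ≤ w₁) {x : ℝ × ℝ}
    {u v : ℤ × ℤ × ℤ} (h : IsBest w₁ w₂ x u) (hv : v ∈ Qset) (hvu : v ≠ u) :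
    Afun w₁ w₂ x u < (2 : ℝ) ^ (1 / w₂) * Afun w₁ w₂ (uhat u) v := by
  have hw₁ : 0 < w₁ := hw₂.trans_le hw
  have hu0 := h.1
  have hdiv := Int.mul_ediv_add_emod v.2.2 u.2.2
  have hlt := Int.emod_lt_of_pos v.2.2 hu0
  have hnonneg := Int.emod_nonneg v.2.2 hu0.ne'
  set k := v.2.2 / u.2.2
  have hden : (v - k • u).2.2 = v.2.2 % u.2.2 := by simp; linarith
  rcases hnonneg.eq_or_lt with hz | hpos
  · rw [← hz] at hden
    rw [← Afun_uhat_sub_smul hu0.ne' v k]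
    have hne : (v - k • u).1 ≠ 0 ∨ (v - k • u).2.1 ≠ 0 := by
      by_contra! hcon
      refine hvu (eq_of_mem_Qset_of_eq_smul hv hu0 (k := k) (sub_eq_zero.1 ?_))
      exact Prod.ext hcon.1 (Prod.ext hcon.2 hden)
    have hone : 1 ≤ Afun w₁ w₂ (uhat u) (v - k • u) := by
      rw [← Afun_neg]
      convert one_le_wnorm_of_ne_zero hw₁ hw₂ hne using 1
      simp only [Afun, Prod.fst_neg, Prod.snd_neg, hden]
      simp
    have h2 : (1 : ℝ) < (2 : ℝ) ^ (1 / w₂) := Real.one_lt_rpow (by norm_num) (by positivity)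
    nlinarith [h.Afun_le_one hw₁ hw₂]
  · rcases le_or_gt (2 * (v.2.2 % u.2.2)) u.2.2 with hle | hgt
    · rw [← Afun_uhat_sub_smul hu0.ne' v k]
      exact h.Afun_lt_of_two_mul_le hw₂ hw (by linarith) (by linarith)
    · have hden' : (-(v - (k + 1) • u)).2.2 = u.2.2 - v.2.2 % u.2.2 := by simp; linarith
      rw [← Afun_uhat_sub_smul hu0.ne' v (k + 1), ← Afun_neg _ _ (uhat u)]
      exact h.Afun_lt_of_two_mul_le hw₂ hw (by linarith) (by linarith)

/-- For `u ∈ Q` with `|u| > 1`, the set `Δ(u)` of points having `u` as a `w`-best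
approximate satisfies `B_w(u, 2^{-1/w₂}·r(u)) ⊆ Δ(u) ⊆ B_w(u, 2^{1/w₂}·r(u))`,
where `B_w(u, ρ) = {x : A(x, u) < ρ}`. -/
theorem ball_subset_delta_subset_ball (w₁ w₂ : ℝ) (hw₂ : 0 < w₂) (hw : w₂ ≤ w₁)
    (hsum : w₁ + w₂ = 1) (u : ℤ × ℤ × ℤ) (hu : u ∈ Qset) (hu1 : 1 < u.2.2) :
    {x : ℝ × ℝ | Afun w₁ w₂ x u < (2 : ℝ) ^ (-(1 / w₂)) * rfun w₁ w₂ u} ⊆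
      {x : ℝ × ℝ | IsBest w₁ w₂ x u} ∧
    {x : ℝ × ℝ | IsBest w₁ w₂ x u} ⊆
      {x : ℝ × ℝ | Afun w₁ w₂ x u < (2 : ℝ) ^ (1 / w₂) * rfun w₁ w₂ u} := by
  refine ⟨fun x hx => ⟨hu.1, fun v hv hlt => ?_, fun p => ?_⟩, fun x hx => ?_⟩
  · exact Afun_lt_of_Afun_lt_rfun hw₂ hw hx hv hlt.le (by rintro rfl; exact hlt.false)
  · by_cases hp : (p.1, p.2, u.2.2) = u
    · rw [hp]
    · exact (Afun_lt_of_Afun_lt_rfun hw₂ hw hx (v := (p.1, p.2, u.2.2)) hu.1 le_rfl hp).le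
  · obtain ⟨v, hv, hvu, hr⟩ := exists_Afun_uhat_eq_rfun (hw₂.trans_le hw) hw₂ hu1
    rw [Set.mem_ofPred_eq, hr]
    exact IsBest.Afun_lt hw₂ hw hx hv hvu
end

section
/- Fix a weight w=(w₁,w₂) with w₁ ≥ w₂ > 0 and w₁+w₂ = 1. Let Sing(w)* = {x ∈ Sing(w) : 1, x₁, x₂ are linearly independent over ℚ}. Then the Hausdorff dimensions of Sing(w)* and of Sing(w) are both at most 2 − 1/(1+w₁). -/
open MeasureTheory

/-- The set of `(w₁,w₂)`-weighted singular vectors in `ℝ²`. -/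
def Sing (w₁ w₂ : ℝ) : Set (EuclideanSpace ℝ (Fin 2)) :=
  {x | ∀ ε : ℝ, 0 < ε → ∃ T₀ : ℝ, 1 < T₀ ∧ ∀ T : ℝ, T₀ < T →
    ∃ p₁ p₂ q : ℤ,
      |(q : ℝ) * x 0 - (p₁ : ℝ)| < ε ^ w₁ * T ^ (-w₁) ∧
      |(q : ℝ) * x 1 - (p₂ : ℝ)| < ε ^ w₂ * T ^ (-w₂) ∧
      0 < q ∧ (q : ℝ) < T}

namespace WeightedSingular

/-- An integer vector `(p₁, p₂, q)`, read either as the rational point `(p₁/q, p₂/q)` or as a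
linear form. -/
abbrev Vec := ℤ × ℤ × ℤ

def dot (a b : Vec) : ℤ := a.1 * b.1 + a.2.1 * b.2.1 + a.2.2 * b.2.2

def cross (a b : Vec) : Vec :=
  (a.2.1 * b.2.2 - a.2.2 * b.2.1, a.2.2 * b.1 - a.1 * b.2.2, a.1 * b.2.1 - a.2.1 * b.1)

/-- Primitivity of an integer vector, in Bézout form. -/
def Prim (a : Vec) : Prop := ∃ c, dot c a = 1

theorem cross_eq_zero_iff {a b : Vec} : cross a b = 0 ↔ a.2.1 * b.2.2 = a.2.2 * b.2.1 ∧
    a.2.2 * b.1 = a.1 * b.2.2 ∧ a.1 * b.2.1 = a.2.1 * b.1 := by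
  simp only [cross, Prod.ext_iff, Prod.fst_zero, Prod.snd_zero, sub_eq_zero]

theorem Prim.exists_eq_smul {a φ : Vec} (hφ : Prim φ) (h : cross a φ = 0) :
    ∃ j : ℤ, a = j • φ := by
  obtain ⟨c, hc⟩ := hφ
  rw [cross_eq_zero_iff] at h
  obtain ⟨h1, h2, h3⟩ := h
  unfold dot at hc
  refine ⟨dot c a, ?_⟩
  simp only [dot, Prod.ext_iff, Prod.smul_fst, Prod.smul_snd, smul_eq_mul]
  refine ⟨?_, ?_, ?_⟩
  · linear_combination (-a.1) * hc + c.2.1 * h3 - c.2.2 * h2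
  · linear_combination (-a.2.1) * hc - c.1 * h3 + c.2.2 * h1
  · linear_combination (-a.2.2) * hc + c.1 * h2 - c.2.1 * h1

theorem Prim.eq_or_eq_neg {a b : Vec} (ha : Prim a) (hb : Prim b) (h : cross a b = 0) :
    a = b ∨ a = -b := by
  obtain ⟨j, rfl⟩ := hb.exists_eq_smul h
  obtain ⟨c, hc⟩ := ha
  have : j * dot c b = 1 := by
    rw [← hc]; simp only [dot, Prod.smul_fst, Prod.smul_snd, smul_eq_mul]; ring
  rcases Int.eq_one_or_neg_one_of_mul_eq_one this with h | h <;> simp [h]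

theorem exists_prim_smul {a : Vec} (ha : a ≠ 0) :
    ∃ g : ℤ, 0 < g ∧ ∃ φ, Prim φ ∧ a = g • φ := by
  obtain ⟨x, y, z⟩ := a
  obtain ⟨d, hd⟩ : ∃ d : ℤ, d = (Int.gcd x y : ℤ) := ⟨_, rfl⟩
  obtain ⟨g, hg⟩ : ∃ g : ℤ, g = (Int.gcd d z : ℤ) := ⟨_, rfl⟩
  have hd0 : d = x * Int.gcdA x y + y * Int.gcdB x y := hd ▸ Int.gcd_eq_gcd_ab x y
  have hg0 : g = d * Int.gcdA d z + z * Int.gcdB d z := hg ▸ Int.gcd_eq_gcd_ab d z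
  have hgd : g ∣ d := hg ▸ Int.gcd_dvd_left ..
  obtain ⟨z', hz⟩ : g ∣ z := hg ▸ Int.gcd_dvd_right ..
  obtain ⟨x', hx⟩ : g ∣ x := hgd.trans (hd ▸ Int.gcd_dvd_left ..)
  obtain ⟨y', hy⟩ : g ∣ y := hgd.trans (hd ▸ Int.gcd_dvd_right ..)
  have hgn : g ≠ 0 := by
    intro h0
    apply ha
    simp only [h0, zero_mul] at hx hy hz
    simp [hx, hy, hz]
  have hgpos : 0 < g := lt_of_le_of_ne (by rw [hg]; positivity) hgn.symm
  refine ⟨g, hgpos, (x', y', z'),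
    ⟨(Int.gcdA x y * Int.gcdA d z, Int.gcdB x y * Int.gcdA d z, Int.gcdB d z), ?_⟩, ?_⟩
  · apply mul_left_cancel₀ hgn
    simp only [dot]
    generalize Int.gcdA x y = s at *
    generalize Int.gcdB x y = t at *
    generalize Int.gcdA d z = s' at *
    generalize Int.gcdB d z = t' at *
    linear_combination (-(s * s')) * hx - (t * s') * hy - t' * hz - hg0 - s' * hd0
  · simp only [Prod.smul_mk, smul_eq_mul, Prod.mk.injEq]; exact ⟨hx, hy, hz⟩

theorem dot_cross_left (a b : Vec) : dot (cross a b) a = 0 := by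
  simp only [dot, cross]; ring

theorem dot_cross_right (a b : Vec) : dot (cross a b) b = 0 := by
  simp only [dot, cross]; ring

theorem dot_smul_left (j : ℤ) (a b : Vec) : dot (j • a) b = j * dot a b := by
  simp only [dot, Prod.smul_fst, Prod.smul_snd, smul_eq_mul]; ring

/-- The vector triple product: two forms vanishing on `a` have cross product parallel to `a`. -/
theorem cross_cross_eq_zero {a b φ : Vec} (ha : dot φ a = 0) (hb : dot φ b = 0) :
    cross (cross a b) φ = 0 := by
  rw [cross_eq_zero_iff]
  simp only [dot, cross] at *
  refine ⟨?_, ?_, ?_⟩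
  · linear_combination b.1 * ha - a.1 * hb
  · linear_combination b.2.1 * ha - a.2.1 * hb
  · linear_combination b.2.2 * ha - a.2.2 * hb

theorem dot_comm (a b : Vec) : dot a b = dot b a := by
  simp only [dot]; ring

theorem dot_eq_zero_of_cross {φ ψ u : Vec} (hψ : ψ ≠ 0) (h : cross ψ φ = 0) (hu : dot ψ u = 0) :
    dot φ u = 0 := by
  rw [cross_eq_zero_iff] at h
  obtain ⟨h1, h2, h3⟩ := h
  have e1 : ψ.1 * dot φ u = 0 := by
    simp only [dot] at *; linear_combination φ.1 * hu + u.2.1 * h3 - u.2.2 * h2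
  have e2 : ψ.2.1 * dot φ u = 0 := by
    simp only [dot] at *; linear_combination φ.2.1 * hu - u.1 * h3 + u.2.2 * h1
  have e3 : ψ.2.2 * dot φ u = 0 := by
    simp only [dot] at *; linear_combination φ.2.2 * hu + u.1 * h2 - u.2.1 * h1
  by_contra hne
  apply hψ
  simp only [mul_eq_zero, hne, or_false] at e1 e2 e3
  ext <;> simp [e1, e2, e3]

theorem cross_ne_zero {a b : Vec} (ha : Prim a) (hb : Prim b) (h0 : 0 < a.2.2)
    (hab : a.2.2 < b.2.2) : cross a b ≠ 0 := by
  intro h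
  rcases ha.eq_or_eq_neg hb h with h | h
  · rw [h] at hab; exact lt_irrefl _ hab
  · rw [h] at h0; simp at h0; rw [h] at hab; simp at hab; omega

theorem abs_det_lt_of_floor_eq {A B N a b c d : ℝ} (hA : 0 < A) (hB : 0 < B) (hN : 0 < N)
    (ha : a ≠ 0) (hc : c ≠ 0) (haA : |a| ≤ A) (hcA : |c| ≤ A)
    (h : ⌊b * A / (a * B) * N⌋ = ⌊d * A / (c * B) * N⌋) : |a * d - b * c| < A * B / N := by
  have h1 := Int.abs_sub_lt_one_of_floor_eq_floor h
  have e : a * d - b * c =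
      -((b * A / (a * B) * N - d * A / (c * B) * N) * (a * c * B / (A * N))) := by
    field_simp; ring
  rw [e, abs_neg, abs_mul]
  have h2 : |a * c * B / (A * N)| ≤ A * B / N := by
    rw [abs_div, abs_mul, abs_mul, abs_of_pos hB, abs_of_pos (mul_pos hA hN)]
    calc |a| * |c| * B / (A * N) ≤ A * A * B / (A * N) := by gcongr
      _ = A * B / N := by field_simp
  have h3 : 0 < |a * c * B / (A * N)| := by
    rw [abs_pos]; positivity
  calc _ < 1 * |a * c * B / (A * N)| := by gcongr
    _ ≤ _ := by rwa [one_mul]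

/-- Primitive forms vanishing on `v` in a box of size `A × B`. -/
def boxForms (v : Vec) (A B : ℝ) : Set Vec :=
  {φ | Prim φ ∧ dot φ v = 0 ∧ |(φ.1 : ℝ)| ≤ A ∧ |(φ.2.1 : ℝ)| ≤ B}

theorem eq_or_eq_neg_of_abs_det_lt {v φ ψ : Vec} (hv : Prim v) (hφ : Prim φ) (hψ : Prim ψ)
    (hφv : dot φ v = 0) (hψv : dot ψ v = 0)
    (h : |(φ.1 : ℝ) * ψ.2.1 - φ.2.1 * ψ.1| < v.2.2) : φ = ψ ∨ φ = -ψ := by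
  have hc : cross (cross φ ψ) v = 0 :=
    cross_cross_eq_zero (by rw [dot_comm, hφv]) (by rw [dot_comm, hψv])
  obtain ⟨j, hj⟩ := hv.exists_eq_smul hc
  apply hφ.eq_or_eq_neg hψ
  have hdet : φ.1 * ψ.2.1 - φ.2.1 * ψ.1 = j * v.2.2 := by
    simpa [cross] using congrArg (fun a : Vec => a.2.2) hj
  have h' : |φ.1 * ψ.2.1 - φ.2.1 * ψ.1| < v.2.2 := by exact_mod_cast h
  have hj0 : j = 0 := by
    by_contra hne
    rw [hdet, abs_mul] at h'
    have : 1 ≤ |j| := Int.one_le_abs hne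
    have := le_abs_self v.2.2
    nlinarith [abs_nonneg v.2.2]
  rw [hj, hj0, zero_smul]

theorem floor_mem_Icc {a b A B : ℝ} {N : ℕ} (hA : 0 < A) (hB : 0 < B) (ha : a ≠ 0)
    (h : |b| * A ≤ |a| * B) :
    ⌊b * A / (a * B) * N⌋ ∈ Finset.Icc (-(N : ℤ)) N := by
  have h1 : |b * A / (a * B)| ≤ 1 := by
    rw [abs_div, abs_mul, abs_mul, abs_of_pos hA, abs_of_pos hB]
    exact div_le_one_of_le₀ h (by positivity)
  rw [abs_le] at h1
  have hN : (0 : ℝ) ≤ N := N.cast_nonneg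
  rw [Finset.mem_Icc, Int.le_floor]
  constructor
  · push_cast; nlinarith
  · have : ((⌊b * A / (a * B) * N⌋ : ℤ) : ℝ) ≤ N := (Int.floor_le _).trans (by nlinarith)
    exact_mod_cast this

open Classical in
/-- Directions of forms in a box are separated, so there are few of them. -/
theorem encard_boxForms_le {v : Vec} {A B : ℝ} {N : ℕ} (hv : Prim v) (hq : 0 < v.2.2)
    (hA : 0 < A) (hB : 0 < B) (hN : 0 < N) (hAB : A * B ≤ N * v.2.2) :
    (boxForms v A B).encard ≤ ((12 * N : ℕ) : ℕ∞) := by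
  have hN' : (0 : ℝ) < N := by exact_mod_cast hN
  have hAB' : A * B / N ≤ v.2.2 := by rw [div_le_iff₀ hN']; linarith
  let f : Vec → Bool × Bool × ℤ := fun φ =>
    if |(φ.2.1 : ℝ)| * A ≤ |(φ.1 : ℝ)| * B then
      (true, decide (0 < φ.1), ⌊(φ.2.1 * A / (φ.1 * B) * N : ℝ)⌋)
    else (false, decide (0 < φ.2.1), ⌊(φ.1 * B / (φ.2.1 * A) * N : ℝ)⌋)
  have key : ∀ φ ∈ boxForms v A B,
      (|(φ.2.1 : ℝ)| * A ≤ |(φ.1 : ℝ)| * B → φ.1 ≠ 0) ∧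
      (¬ |(φ.2.1 : ℝ)| * A ≤ |(φ.1 : ℝ)| * B → φ.2.1 ≠ 0) := by
    rintro φ ⟨⟨c, hc⟩, h2, -, -⟩
    constructor
    · intro h h0
      simp only [h0, Int.cast_zero, abs_zero, zero_mul] at h
      have h1 : φ.2.1 = 0 := by
        have : |(φ.2.1 : ℝ)| ≤ 0 := by nlinarith [abs_nonneg (φ.2.1 : ℝ)]
        exact_mod_cast abs_nonpos_iff.1 this
      simp only [dot, h0, h1, zero_mul, zero_add, mul_eq_zero, hq.ne', or_false] at h2
      simp [dot, h0, h1, h2] at hc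
    · intro h h0
      apply h
      simp only [h0, Int.cast_zero, abs_zero, zero_mul]
      positivity
  let t : Finset (Bool × Bool × ℤ) :=
    Finset.univ ×ˢ (Finset.univ ×ˢ Finset.Icc (-(N : ℤ)) N)
  have hmaps : Set.MapsTo f (boxForms v A B) t := by
    intro φ hφ
    simp only [f, t, Finset.coe_product, Finset.coe_univ, Set.mem_prod, Set.mem_univ, true_and,
      Finset.mem_coe]
    split_ifs with h
    · exact floor_mem_Icc hA hB (by exact_mod_cast (key φ hφ).1 h) h
    · exact floor_mem_Icc hB hA (by exact_mod_cast (key φ hφ).2 h) (not_le.1 h).le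
  have hinj : Set.InjOn f (boxForms v A B) := by
    intro φ hφ ψ hψ hf
    obtain ⟨k1, k2⟩ := key φ hφ
    obtain ⟨l1, l2⟩ := key ψ hψ
    obtain ⟨hφp, hφv, hφA, hφB⟩ := hφ
    obtain ⟨hψp, hψv, hψA, hψB⟩ := hψ
    simp only [f] at hf
    split_ifs at hf with h h' h' <;>
      simp only [Prod.mk.injEq, decide_eq_decide, true_and, reduceCtorEq, false_and] at hf
    · have := abs_det_lt_of_floor_eq hA hB hN' (by exact_mod_cast k1 h) (by exact_mod_cast l1 h')
        hφA hψA hf.2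
      refine (eq_or_eq_neg_of_abs_det_lt hv hφp hψp hφv hψv
        (this.trans_le hAB')).resolve_right fun e => ?_
      have e1 : φ.1 = -ψ.1 := by rw [e]; simp
      have := k1 h
      omega
    · have := abs_det_lt_of_floor_eq hB hA hN' (by exact_mod_cast k2 h) (by exact_mod_cast l2 h')
        hφB hψB hf.2
      refine (eq_or_eq_neg_of_abs_det_lt hv hφp hψp hφv hψv ?_).resolve_right fun e => ?_
      · rw [abs_sub_comm]
        rw [mul_comm B A] at this
        exact this.trans_le hAB'
      · have e1 : φ.2.1 = -ψ.2.1 := by rw [e]; simp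
        have := k2 h
        omega
  refine (Set.encard_le_encard_of_injOn hmaps hinj).trans ?_
  rw [Set.encard_coe_eq_coe_finsetCard]
  norm_cast
  simp only [t, Finset.card_product, Finset.card_univ, Fintype.card_bool, Int.card_Icc]
  omega

/-- Rational vectors on the rational line `φ` at level `j` from `v`, with denominator at
least `Y`. -/
def lineVecs (v φ : Vec) (j : ℤ) (Y : ℝ) : Set Vec :=
  {u | cross v u = j • φ ∧ Y ≤ u.2.2}

theorem sum_inv_sq_le (y : ℝ) (hy : 1 ≤ y) (n : ℕ) :
    ∑ l ∈ Finset.range n, (1 / (y + l) ^ 2) ≤ 2 / y - 2 / (y + n) := by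
  induction n with
  | zero => simp
  | succ n ih =>
    rw [Finset.sum_range_succ]
    have hn : (0 : ℝ) ≤ n := n.cast_nonneg
    have : 1 / (y + n) ^ 2 ≤ 2 / (y + n) - 2 / (y + (n + 1 : ℕ)) := by
      push_cast
      have hz : (1 : ℝ) ≤ y + n := by linarith
      rw [← add_assoc]
      generalize y + (n : ℝ) = z at *
      rw [div_sub_div _ _ (by positivity) (by positivity), div_le_div_iff₀ (by positivity)
        (by positivity)]
      nlinarith
    linarith

/-- The weight of a rational vector. -/
noncomputable def wt (δ : ℝ) (v : Vec) : ENNReal := ENNReal.ofReal ((v.2.2 : ℝ) ^ (-(2 + δ)))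

theorem tsum_lineVecs_le {δ : ℝ} (hδ : 0 < δ) {v φ : Vec} {j : ℤ} {Y : ℝ} (hv : Prim v)
    (hq : 0 < v.2.2) (hY : v.2.2 ≤ Y) :
    ∑' u : lineVecs v φ j Y, wt δ u ≤
      ENNReal.ofReal (2 / v.2.2 * Y ^ (-(1 + δ))) := by
  have hq' : (0 : ℝ) < v.2.2 := by exact_mod_cast hq
  have hY0 : 0 < Y := hq'.trans_le hY
  set q : ℝ := ((v.2.2 : ℤ) : ℝ) with hqdef
  let l : lineVecs v φ j Y → ℕ := fun u => ⌊((u : Vec).2.2 - Y) / q⌋₊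
  have hl : Function.Injective l := by
    rintro ⟨u, hu, huY⟩ ⟨u', hu', huY'⟩ h
    simp only [l] at h
    have h1 : |(((u.2.2 : ℝ) - Y) / q) - ((u'.2.2 : ℝ) - Y) / q| < 1 := by
      have a1 : 0 ≤ ((u.2.2 : ℝ) - Y) / q := div_nonneg (by linarith) hq'.le
      have a2 : 0 ≤ ((u'.2.2 : ℝ) - Y) / q := div_nonneg (by linarith) hq'.le
      have b1 := Nat.floor_le a1
      have b2 := Nat.floor_le a2
      have c1 := Nat.lt_floor_add_one (((u.2.2 : ℝ) - Y) / q)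
      have c2 := Nat.lt_floor_add_one (((u'.2.2 : ℝ) - Y) / q)
      rw [h] at b1 c1
      rw [abs_lt]; constructor <;> linarith
    rw [← sub_div, abs_div, abs_of_pos hq', div_lt_one hq', sub_sub_sub_cancel_right] at h1
    have hc : cross (u - u') v = 0 := by
      have := hu.trans hu'.symm
      simp only [cross, Prod.mk.injEq] at this
      rw [cross_eq_zero_iff]
      simp only [Prod.fst_sub, Prod.snd_sub]
      obtain ⟨t1, t2, t3⟩ := this
      refine ⟨by linear_combination -t1, by linear_combination -t2, by linear_combination -t3⟩
    obtain ⟨i, hi⟩ := hv.exists_eq_smul hc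
    have h2 : u.2.2 - u'.2.2 = i * v.2.2 := by
      simpa using congrArg (fun a : Vec => a.2.2) hi
    have h3 : |u.2.2 - u'.2.2| < v.2.2 := by
      rw [hqdef] at h1; exact_mod_cast h1
    have hi0 : i = 0 := by
      by_contra hne
      rw [h2, abs_mul, abs_of_pos hq] at h3
      have : 1 ≤ |i| := Int.one_le_abs hne
      nlinarith
    rw [hi0, zero_smul, sub_eq_zero] at hi
    exact Subtype.ext hi
  have hterm : ∀ u : lineVecs v φ j Y, wt δ u ≤
      ENNReal.ofReal (Y ^ (-δ) * (1 / q ^ 2) * (1 / (Y / q + l u) ^ 2)) := by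
    rintro ⟨u, hu, huY⟩
    apply ENNReal.ofReal_le_ofReal
    have a1 : 0 ≤ ((u.2.2 : ℝ) - Y) / q := div_nonneg (by linarith) hq'.le
    have b1 := Nat.floor_le a1
    rw [le_div_iff₀ hq'] at b1
    have hpos : (0 : ℝ) < u.2.2 := hY0.trans_le huY
    simp only [l]
    generalize ⌊((u.2.2 : ℝ) - Y) / q⌋₊ = n at *
    have hn : (0 : ℝ) ≤ n := n.cast_nonneg
    have hx : Y + n * q ≤ u.2.2 := by linarith
    have e : (1 / q ^ 2) * (1 / (Y / q + n) ^ 2) = 1 / (Y + n * q) ^ 2 := by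
      field_simp
    rw [mul_assoc, e, neg_add, add_comm, Real.rpow_add hpos]
    have h2 : (u.2.2 : ℝ) ^ (-2 : ℝ) = 1 / (u.2.2 : ℝ) ^ 2 := by
      rw [Real.rpow_neg hpos.le]; norm_num
    rw [h2]
    apply mul_le_mul _ _ (by positivity) (by positivity)
    · exact Real.rpow_le_rpow_of_nonpos hY0 huY (by linarith)
    · gcongr
  have hy : 1 ≤ Y / q := by rwa [one_le_div hq']
  calc ∑' u : lineVecs v φ j Y, wt δ u
      ≤ ∑' u : lineVecs v φ j Y,
        ENNReal.ofReal (Y ^ (-δ) * (1 / q ^ 2) * (1 / (Y / q + l u) ^ 2)) :=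
        ENNReal.tsum_le_tsum hterm
    _ ≤ ∑' n : ℕ, ENNReal.ofReal (Y ^ (-δ) * (1 / q ^ 2) * (1 / (Y / q + n) ^ 2)) :=
        ENNReal.tsum_comp_le_tsum_of_injective hl
          fun n : ℕ => ENNReal.ofReal (Y ^ (-δ) * (1 / q ^ 2) * (1 / (Y / q + n) ^ 2))
    _ ≤ ENNReal.ofReal (2 / q * Y ^ (-(1 + δ))) := by
      rw [ENNReal.tsum_eq_iSup_nat]
      refine iSup_le fun n => ?_
      rw [← ENNReal.ofReal_sum_of_nonneg fun i _ => by positivity]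
      apply ENNReal.ofReal_le_ofReal
      rw [← Finset.mul_sum]
      have h1 : ∑ i ∈ Finset.range n, (1 / (Y / q + i) ^ 2) ≤ 2 / (Y / q) := by
        refine (sum_inv_sq_le (Y / q) hy n).trans ?_
        have : 0 ≤ 2 / (Y / q + n) := by positivity
        linarith
      calc _ ≤ Y ^ (-δ) * (1 / q ^ 2) * (2 / (Y / q)) := by gcongr
        _ = 2 / q * Y ^ (-(1 + δ)) := by
          rw [neg_add, Real.rpow_add hY0, Real.rpow_neg_one]
          field_simp

/-- `v'` may follow `v` in the chain of vectors at which the best approximations turn. -/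
def Step (w₁ w₂ ε : ℝ) (v v' : Vec) : Prop :=
  Prim v ∧ 0 < v.2.2 ∧ ∃ (k : ℕ) (φ : Vec) (j : ℤ), j ≠ 0 ∧
    φ ∈ boxForms v (2 * ε ^ w₂ * (2 ^ (k + 1) * (v.2.2 / (8 * ε))) ^ w₁)
      (2 * ε ^ w₁ * (2 ^ (k + 1) * (v.2.2 / (8 * ε))) ^ w₂) ∧
    v' ∈ lineVecs v φ j (|(j : ℝ)| * (2 ^ k * (v.2.2 / (8 * ε))))

theorem Step.growth {w₁ w₂ ε : ℝ} (hε : 0 < ε) (hε' : ε ≤ 1 / 16) {v v' : Vec}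
    (h : Step w₁ w₂ ε v v') : 2 * v.2.2 ≤ v'.2.2 := by
  obtain ⟨-, hq, k, φ, j, hj, -, -, h⟩ := h
  have hq' : (0 : ℝ) < v.2.2 := by exact_mod_cast hq
  have hj' : (1 : ℝ) ≤ |(j : ℝ)| := by exact_mod_cast Int.one_le_abs hj
  have hk : (1 : ℝ) ≤ 2 ^ k := one_le_pow₀ (by norm_num)
  have h1 : 2 * (v.2.2 : ℝ) ≤ v.2.2 / (8 * ε) := by
    rw [le_div_iff₀ (by positivity)]; nlinarith
  have h2 : (v.2.2 : ℝ) / (8 * ε) ≤ |(j : ℝ)| * (2 ^ k * (v.2.2 / (8 * ε))) := by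
    rw [← mul_assoc]
    exact le_mul_of_one_le_left (by positivity) (one_le_mul_of_one_le_of_one_le hj' hk)
  exact_mod_cast h1.trans (h2.trans h)

theorem tsum_step_le {w₁ w₂ ε δ : ℝ} (hsum : w₁ + w₂ = 1) (hδ : 0 < δ) (hε : 0 < ε)
    (hε' : ε ≤ 1 / 16) (v : Vec) :
    ∑' u : {u | Step w₁ w₂ ε v u}, wt δ u ≤
      ENNReal.ofReal (24 * (8 * ε) ^ (1 + δ)) *
        (∑' j : ℤ, ENNReal.ofReal (|(j : ℝ)| ^ (-(1 + δ)))) *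
        (∑' k : ℕ, ENNReal.ofReal ((2 ^ (-δ)) ^ k)) * wt δ v := by
  by_cases hv : Prim v ∧ 0 < v.2.2
  swap
  · have : {u | Step w₁ w₂ ε v u} = ∅ := by
      ext u
      simp only [Set.mem_ofPred_eq, Set.mem_empty_iff_false, iff_false]
      exact fun h => hv ⟨h.1, h.2.1⟩
    rw [this]; simp
  obtain ⟨hv, hq⟩ := hv
  have hq' : (0 : ℝ) < v.2.2 := by exact_mod_cast hq
  set q : ℝ := ((v.2.2 : ℤ) : ℝ) with hqdef
  set r : ℝ := q / (8 * ε) with hr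
  have hr0 : 0 < r := by positivity
  have hqr : q ≤ r := by
    rw [hr, le_div_iff₀ (by positivity)]; nlinarith
  let F : ℕ → Set Vec := fun k => boxForms v (2 * ε ^ w₂ * (2 ^ (k + 1) * r) ^ w₁)
      (2 * ε ^ w₁ * (2 ^ (k + 1) * r) ^ w₂)
  let L : ℕ → Vec → ℤ → Set Vec := fun k φ j =>
    if j = 0 then ∅ else lineVecs v φ j (|(j : ℝ)| * (2 ^ k * r))
  have hsub : {u | Step w₁ w₂ ε v u} ⊆ ⋃ k, ⋃ φ ∈ F k, ⋃ j, L k φ j := by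
    rintro u ⟨-, -, k, φ, j, hj, hφ, hu⟩
    simp only [Set.mem_iUnion]
    refine ⟨k, φ, hφ, j, ?_⟩
    simp only [L, if_neg hj]
    exact hu
  let c : ℕ → ℝ := fun k => 2 / q * (2 ^ k * r) ^ (-(1 + δ))
  have hL : ∀ k φ j, ∑' u : L k φ j, wt δ u ≤
      ENNReal.ofReal (c k) * ENNReal.ofReal (|(j : ℝ)| ^ (-(1 + δ))) := by
    intro k φ j
    by_cases hj : j = 0
    · have : L k φ j = ∅ := by simp [L, hj]
      rw [this]; simp
    have hLj : L k φ j = lineVecs v φ j (|(j : ℝ)| * (2 ^ k * r)) := by simp [L, hj]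
    have hj' : (1 : ℝ) ≤ |(j : ℝ)| := by exact_mod_cast Int.one_le_abs hj
    have hk : (1 : ℝ) ≤ 2 ^ k := one_le_pow₀ (by norm_num)
    have hY : q ≤ |(j : ℝ)| * (2 ^ k * r) := by
      rw [← mul_assoc]
      exact hqr.trans (le_mul_of_one_le_left hr0.le (one_le_mul_of_one_le_of_one_le hj' hk))
    rw [hLj]
    refine (tsum_lineVecs_le hδ hv hq hY).trans (le_of_eq ?_)
    rw [← ENNReal.ofReal_mul (by positivity), Real.mul_rpow (by positivity) (by positivity)]
    congr 1
    simp only [c]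
    ring
  have hF : ∀ k, (F k).encard ≤ ((12 * 2 ^ k : ℕ) : ℕ∞) := by
    intro k
    apply encard_boxForms_le hv hq (by positivity) (by positivity) (by positivity)
    have h1 : ε ^ w₂ * ε ^ w₁ = ε := by
      rw [← Real.rpow_add hε, add_comm, hsum, Real.rpow_one]
    have h2 : (2 ^ (k + 1) * r) ^ w₁ * (2 ^ (k + 1) * r) ^ w₂ = 2 ^ (k + 1) * r := by
      rw [← Real.rpow_add (by positivity), hsum, Real.rpow_one]
    apply le_of_eq
    calc _ = 4 * (ε ^ w₂ * ε ^ w₁) *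
          ((2 ^ (k + 1) * r) ^ w₁ * (2 ^ (k + 1) * r) ^ w₂) := by ring
      _ = _ := by
        rw [h1, h2, hr]; push_cast; field_simp; ring
  have hck : ∀ k, ((12 * 2 ^ k : ℕ) : ENNReal) * ENNReal.ofReal (c k) =
      ENNReal.ofReal (24 * (8 * ε) ^ (1 + δ)) * wt δ v *
        ENNReal.ofReal ((2 ^ (-δ)) ^ k) := by
    intro k
    rw [wt, ← ENNReal.ofReal_natCast, ← ENNReal.ofReal_mul (by positivity),
      ← ENNReal.ofReal_mul (by positivity), ← ENNReal.ofReal_mul (by positivity)]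
    congr 1
    have e1 : ((2 : ℝ) ^ k) ^ (-(1 + δ)) = (2 ^ k)⁻¹ * (2 ^ (-δ)) ^ k := by
      rw [neg_add, Real.rpow_add (by positivity), Real.rpow_neg_one, ← Real.rpow_natCast,
        ← Real.rpow_natCast, ← Real.rpow_mul (by norm_num), ← Real.rpow_mul (by norm_num),
        mul_comm (k : ℝ)]
    have e2 : r ^ (-(1 + δ)) = (8 * ε) ^ (1 + δ) * q ^ (-(1 + δ)) := by
      rw [hr, Real.div_rpow hq'.le (by positivity), Real.rpow_neg (by positivity : 0 ≤ 8 * ε)]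
      field_simp
    have e3 : q ^ (-(2 + δ)) = q⁻¹ * q ^ (-(1 + δ)) := by
      rw [← Real.rpow_neg_one, ← Real.rpow_add hq']; congr 1; ring
    simp only [c]
    rw [Real.mul_rpow (by positivity) hr0.le, e1, e2, ← hqdef, e3]
    push_cast
    field_simp
    ring
  calc ∑' u : {u | Step w₁ w₂ ε v u}, wt δ u
      ≤ ∑' u : ⋃ k, ⋃ φ ∈ F k, ⋃ j, L k φ j, wt δ u := ENNReal.tsum_mono_subtype _ hsub
    _ ≤ ∑' k, ∑' φ : F k, ∑' j, ∑' u : L k φ j, wt δ u := by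
      refine (ENNReal.tsum_iUnion_le_tsum _ _).trans (ENNReal.tsum_le_tsum fun k => ?_)
      refine (ENNReal.tsum_biUnion_le_tsum _ _ _).trans (ENNReal.tsum_le_tsum fun φ => ?_)
      exact ENNReal.tsum_iUnion_le_tsum _ _
    _ ≤ ∑' k, ∑' _ : F k, ∑' j : ℤ,
          ENNReal.ofReal (c k) * ENNReal.ofReal (|(j : ℝ)| ^ (-(1 + δ))) :=
      ENNReal.tsum_le_tsum fun k => ENNReal.tsum_le_tsum fun φ => ENNReal.tsum_le_tsum fun j =>
        hL k φ j
    _ ≤ ∑' k : ℕ, ENNReal.ofReal (24 * (8 * ε) ^ (1 + δ)) * wt δ v *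
        ENNReal.ofReal ((2 ^ (-δ)) ^ k) *
          ∑' j : ℤ, ENNReal.ofReal (|(j : ℝ)| ^ (-(1 + δ))) := by
      refine ENNReal.tsum_le_tsum fun k => ?_
      rw [ENNReal.tsum_mul_left, ENNReal.tsum_set_const, ← hck k, mul_assoc]
      gcongr
      exact_mod_cast hF k
    _ = _ := by
      rw [ENNReal.tsum_mul_right, ENNReal.tsum_mul_left]
      ring

theorem exists_tsum_step_le {w₁ w₂ δ : ℝ} (hsum : w₁ + w₂ = 1) (hδ : 0 < δ) :
    ∃ ε₀ : ℝ, 0 < ε₀ ∧ ∀ ε, 0 < ε → ε ≤ ε₀ → ∀ v : Vec,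
      ∑' u : {u | Step w₁ w₂ ε v u}, wt δ u ≤ 2⁻¹ * wt δ v := by
  set S := (∑' j : ℤ, ENNReal.ofReal (|(j : ℝ)| ^ (-(1 + δ)))) *
        (∑' k : ℕ, ENNReal.ofReal (((2 : ℝ) ^ (-δ)) ^ k)) with hS
  have hS' : S ≠ ⊤ := by
    refine ENNReal.mul_ne_top ?_ ?_
    · exact (Real.summable_abs_int_rpow (by linarith : 1 < 1 + δ)).tsum_ofReal_ne_top
    · refine (summable_geometric_of_lt_one (by positivity) ?_).tsum_ofReal_ne_top
      exact Real.rpow_lt_one_of_one_lt_of_neg (by norm_num) (by linarith)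
  have hS0 : 0 ≤ S.toReal := ENNReal.toReal_nonneg
  refine ⟨min (1 / 16) (1 / (384 * (S.toReal + 1))), by positivity, fun ε hε hε0 v => ?_⟩
  have h1 : ε ≤ 1 / 16 := hε0.trans (min_le_left _ _)
  have h2 : ε ≤ 1 / (384 * (S.toReal + 1)) := hε0.trans (min_le_right _ _)
  refine (tsum_step_le hsum hδ hε h1 v).trans ?_
  gcongr
  rw [mul_assoc, ← hS, ← ENNReal.ofReal_toReal hS', ← ENNReal.ofReal_mul (by positivity)]
  have h3 : (8 * ε) ^ (1 + δ) ≤ 8 * ε := by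
    have := Real.rpow_le_rpow_of_exponent_ge (by positivity : 0 < 8 * ε) (by linarith)
      (by linarith : (1 : ℝ) ≤ 1 + δ)
    rwa [Real.rpow_one] at this
  have h4 : 24 * (8 * ε) ^ (1 + δ) * S.toReal ≤ 2⁻¹ := by
    rw [le_div_iff₀ (by positivity)] at h2
    nlinarith
  calc _ ≤ ENNReal.ofReal 2⁻¹ := ENNReal.ofReal_le_ofReal h4
    _ = 2⁻¹ := by rw [ENNReal.ofReal_inv_of_pos (by norm_num)]; norm_num

/-- The vectors reached from `v` in `n` steps. -/
def reach (w₁ w₂ ε : ℝ) (v : Vec) : ℕ → Set Vec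
  | 0 => {v}
  | n + 1 => ⋃ u ∈ reach w₁ w₂ ε v n, {u' | Step w₁ w₂ ε u u'}

theorem tsum_reach_le {w₁ w₂ ε δ : ℝ}
    (h : ∀ v : Vec, ∑' u : {u | Step w₁ w₂ ε v u}, wt δ u ≤ 2⁻¹ * wt δ v) (v : Vec) (n : ℕ) :
    ∑' u : reach w₁ w₂ ε v n, wt δ u ≤ wt δ v := by
  induction n with
  | zero => simp [reach]
  | succ n ih =>
    rw [reach]
    refine (ENNReal.tsum_biUnion_le_tsum _ _ _).trans (le_trans ?_ ih)
    refine ENNReal.tsum_le_tsum fun u => (h u).trans ?_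
    refine mul_le_of_le_one_left' ?_
    simp

theorem two_pow_le_of_mem_reach {w₁ w₂ ε : ℝ} (hε : 0 < ε) (hε' : ε ≤ 1 / 16) {v : Vec}
    (hv : 0 < v.2.2) (n : ℕ) {u : Vec} (hu : u ∈ reach w₁ w₂ ε v n) : 2 ^ n ≤ u.2.2 := by
  induction n generalizing u with
  | zero =>
    rw [reach, Set.mem_singleton_iff] at hu
    rw [hu, pow_zero]; omega
  | succ n ih =>
    simp only [reach, Set.mem_iUnion] at hu
    obtain ⟨u', hu', hs⟩ := hu
    have h1 := ih hu'
    have h2 := Step.growth hε hε' hs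
    rw [pow_succ]; omega

/-- The points approximated along an infinite chain of steps starting at `v`. -/
def chainLimits (w₁ w₂ ε : ℝ) (v : Vec) : Set (EuclideanSpace ℝ (Fin 2)) :=
  {x | ∃ c : ℕ → Vec, c 0 = v ∧ (∀ n, Step w₁ w₂ ε (c n) (c (n + 1))) ∧
    ∀ n, |x 0 - (c n).1 / (c n).2.2| ≤ ((c n).2.2 : ℝ) ^ (-1 - w₁) ∧
      |x 1 - (c n).2.1 / (c n).2.2| ≤ ((c n).2.2 : ℝ) ^ (-1 - w₂)}

/-- The `i`-th roughly square piece of the box of points approximated by `u`. -/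
def piece (w₁ w₂ : ℝ) (u : Vec) (i : ℕ) : Set (EuclideanSpace ℝ (Fin 2)) :=
  {x | |x 0 - u.1 / u.2.2| ≤ (u.2.2 : ℝ) ^ (-1 - w₁) ∧
    |x 1 - (u.2.1 / u.2.2 - (u.2.2 : ℝ) ^ (-1 - w₂) + i * (u.2.2 : ℝ) ^ (-1 - w₁))| ≤
      (u.2.2 : ℝ) ^ (-1 - w₁)}

theorem ediam_piece_le {w₁ w₂ : ℝ} {u : Vec} (hu : 0 < u.2.2) (i : ℕ) :
    Metric.ediam (piece w₁ w₂ u i) ≤ ENNReal.ofReal (3 * (u.2.2 : ℝ) ^ (-1 - w₁)) := by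
  have hu' : (0 : ℝ) < u.2.2 := by exact_mod_cast hu
  refine Metric.ediam_le fun x hx y hy => ?_
  rw [edist_dist]
  apply ENNReal.ofReal_le_ofReal
  obtain ⟨x1, x2⟩ := hx
  obtain ⟨y1, y2⟩ := hy
  have hρ : 0 < (u.2.2 : ℝ) ^ (-1 - w₁) := by positivity
  generalize (u.2.2 : ℝ) ^ (-1 - w₁) = ρ at *
  rw [EuclideanSpace.dist_eq, Real.sqrt_le_left (by positivity), Fin.sum_univ_two,
    Real.dist_eq, Real.dist_eq, sq_abs, sq_abs]
  rw [abs_le] at x1 x2 y1 y2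
  have h1 : |x 0 - y 0| ≤ 2 * ρ := by rw [abs_le]; constructor <;> linarith
  have h2 : |x 1 - y 1| ≤ 2 * ρ := by rw [abs_le]; constructor <;> linarith
  have := sq_le_sq' (abs_le.1 h1).1 (abs_le.1 h1).2
  have := sq_le_sq' (abs_le.1 h2).1 (abs_le.1 h2).2
  nlinarith

/-- The number of pieces needed to cover the box of points approximated by `u`. -/
noncomputable def numPieces (w₁ w₂ : ℝ) (u : Vec) : ℕ := ⌊2 * (u.2.2 : ℝ) ^ (w₁ - w₂)⌋₊ + 1

theorem exists_mem_piece {w₁ w₂ : ℝ} {u : Vec} (hu : 0 < u.2.2)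
    {x : EuclideanSpace ℝ (Fin 2)} (h0 : |x 0 - u.1 / u.2.2| ≤ (u.2.2 : ℝ) ^ (-1 - w₁))
    (h1 : |x 1 - u.2.1 / u.2.2| ≤ (u.2.2 : ℝ) ^ (-1 - w₂)) :
    ∃ i : Fin (numPieces w₁ w₂ u), x ∈ piece w₁ w₂ u i := by
  have hu' : (0 : ℝ) < u.2.2 := by exact_mod_cast hu
  have e : 2 * (u.2.2 : ℝ) ^ (w₁ - w₂) * (u.2.2 : ℝ) ^ (-1 - w₁) =
      2 * (u.2.2 : ℝ) ^ (-1 - w₂) := by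
    rw [mul_assoc, ← Real.rpow_add hu']; congr 2; ring
  have hρ : 0 < (u.2.2 : ℝ) ^ (-1 - w₁) := by positivity
  have hm : 0 ≤ (u.2.2 : ℝ) ^ (w₁ - w₂) := by positivity
  simp only [piece, numPieces, Set.mem_ofPred_eq]
  generalize (u.2.2 : ℝ) ^ (-1 - w₁) = ρ at *
  generalize (u.2.2 : ℝ) ^ (-1 - w₂) = σ at *
  generalize (u.2.2 : ℝ) ^ (w₁ - w₂) = m at *
  rw [abs_le] at h1
  set z := (x 1 - u.2.1 / u.2.2 + σ) / ρ with hz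
  have hz0 : 0 ≤ z := div_nonneg (by linarith) hρ.le
  have hzm : z ≤ 2 * m := by
    rw [hz, div_le_iff₀ hρ, e]; linarith
  have hzρ : z * ρ = x 1 - u.2.1 / u.2.2 + σ := by rw [hz]; field_simp
  refine ⟨⟨⌊z⌋₊, Nat.lt_succ_of_le (Nat.floor_le_floor hzm)⟩, h0, ?_⟩
  have b1 := Nat.floor_le hz0
  have b2 := Nat.lt_floor_add_one z
  rw [abs_le]
  constructor <;> nlinarith

theorem dimH_chainLimits_le {w₁ w₂ ε δ s : ℝ} (hw₂ : 0 < w₂) (hw : w₂ ≤ w₁) (hs0 : 0 ≤ s)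
    (hs : (1 + w₁) * s = 2 + w₁ - w₂ + δ) (hε : 0 < ε) (hε' : ε ≤ 1 / 16)
    (h : ∀ v : Vec, ∑' u : {u | Step w₁ w₂ ε v u}, wt δ u ≤ 2⁻¹ * wt δ v) {v : Vec}
    (hv : 0 < v.2.2) : dimH (chainLimits w₁ w₂ ε v) ≤ ENNReal.ofReal s := by
  have hpos : ∀ n, ∀ u ∈ reach w₁ w₂ ε v n, (1 : ℝ) ≤ u.2.2 ∧ 0 < u.2.2 ∧
      (2 : ℝ) ^ n ≤ u.2.2 := by
    intro n u hu
    have h1 := two_pow_le_of_mem_reach hε hε' hv n hu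
    have h2 : (1 : ℤ) ≤ 2 ^ n := one_le_pow₀ (by norm_num)
    exact ⟨by exact_mod_cast h2.trans h1, by omega, by exact_mod_cast h1⟩
  refine dimH_le_of_hausdorffMeasure_ne_top (d := s.toNNReal) ?_
  rw [Real.coe_toNNReal s hs0]
  refine ne_top_of_le_ne_top (b := ENNReal.ofReal (3 * 3 ^ s) * wt δ v)
    (ENNReal.mul_ne_top ENNReal.ofReal_ne_top ENNReal.ofReal_ne_top) ?_
  let ι : ℕ → Type := fun n => Σ u : reach w₁ w₂ ε v n, Fin (numPieces w₁ w₂ u)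
  refine (Measure.hausdorffMeasure_le_liminf_tsum (ι := ι) (l := Filter.atTop) s _
    (fun n => ENNReal.ofReal (3 * (1 / 2) ^ n)) ?_
    (fun n i => piece w₁ w₂ i.1 i.2) (Filter.Eventually.of_forall fun n i => ?_)
    (Filter.Eventually.of_forall fun n => ?_)).trans ?_
  · have : Filter.Tendsto (fun n : ℕ => (3 : ℝ) * (1 / 2) ^ n) Filter.atTop (nhds 0) := by
      simpa using (tendsto_pow_atTop_nhds_zero_of_lt_one (by norm_num : (0 : ℝ) ≤ 1 / 2)
        (by norm_num)).const_mul 3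
    simpa using ENNReal.tendsto_ofReal this
  · obtain ⟨⟨u, hu⟩, i⟩ := i
    obtain ⟨h1, h2, h3⟩ := hpos n u hu
    refine (ediam_piece_le h2 i).trans (ENNReal.ofReal_le_ofReal ?_)
    gcongr
    calc (u.2.2 : ℝ) ^ (-1 - w₁) ≤ (u.2.2 : ℝ) ^ (-1 : ℝ) :=
          Real.rpow_le_rpow_of_exponent_le h1 (by linarith)
      _ ≤ (1 / 2) ^ n := by
        rw [Real.rpow_neg_one, one_div, inv_pow]
        gcongr
  · rintro x ⟨c, hc0, hc, hx⟩
    have hcn : ∀ n, c n ∈ reach w₁ w₂ ε v n := by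
      intro n
      induction n with
      | zero => simp [reach, hc0]
      | succ n ih =>
        simp only [reach, Set.mem_iUnion]
        exact ⟨_, ih, hc n⟩
    obtain ⟨i, hi⟩ := exists_mem_piece (hpos n _ (hcn n)).2.1 (hx n).1 (hx n).2
    exact Set.mem_iUnion.2 ⟨⟨⟨c n, hcn n⟩, i⟩, hi⟩
  · refine Filter.liminf_le_of_le (by isBoundedDefault) fun b hb => ?_
    obtain ⟨n, hn⟩ := hb.exists
    refine hn.trans ?_
    rw [ENNReal.tsum_sigma']
    calc _ ≤ ∑' u : reach w₁ w₂ ε v n, ENNReal.ofReal (3 * 3 ^ s) * wt δ u := by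
          refine ENNReal.tsum_le_tsum fun u => ?_
          obtain ⟨u, hu⟩ := u
          obtain ⟨h1, h2, -⟩ := hpos n u hu
          have h0 : (0 : ℝ) < u.2.2 := by linarith
          have hm : 1 ≤ (u.2.2 : ℝ) ^ (w₁ - w₂) := Real.one_le_rpow h1 (by linarith)
          rw [tsum_fintype]
          calc _ ≤ ∑ _ : Fin (numPieces w₁ w₂ u),
                ENNReal.ofReal ((3 * (u.2.2 : ℝ) ^ (-1 - w₁)) ^ s) := by
                refine Finset.sum_le_sum fun i _ => ?_
                rw [← ENNReal.ofReal_rpow_of_nonneg (by positivity) hs0]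
                exact ENNReal.rpow_le_rpow (ediam_piece_le h2 i) hs0
            _ = ENNReal.ofReal (numPieces w₁ w₂ u * (3 * (u.2.2 : ℝ) ^ (-1 - w₁)) ^ s) := by
                rw [Finset.sum_const, Finset.card_univ, Fintype.card_fin, nsmul_eq_mul,
                  ENNReal.ofReal_mul (by positivity), ENNReal.ofReal_natCast]
            _ ≤ ENNReal.ofReal (3 * (u.2.2 : ℝ) ^ (w₁ - w₂) *
                  (3 * (u.2.2 : ℝ) ^ (-1 - w₁)) ^ s) := by
                gcongr
                rw [numPieces]; push_cast
                have := Nat.floor_le (by positivity : 0 ≤ 2 * (u.2.2 : ℝ) ^ (w₁ - w₂))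
                linarith
            _ = _ := by
                rw [wt, ← ENNReal.ofReal_mul (by positivity),
                  Real.mul_rpow (by norm_num) (by positivity), ← Real.rpow_mul h0.le]
                have : (u.2.2 : ℝ) ^ (-(2 + δ)) = (u.2.2 : ℝ) ^ (w₁ - w₂) *
                    (u.2.2 : ℝ) ^ ((-1 - w₁) * s) := by
                  rw [← Real.rpow_add h0]; congr 1; linarith
                rw [this]; congr 1; ring
      _ = ENNReal.ofReal (3 * 3 ^ s) * ∑' u : reach w₁ w₂ ε v n, wt δ u :=
          ENNReal.tsum_mul_left
      _ ≤ _ := by gcongr; exact tsum_reach_le h v n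

/-- The weighted size of `q x - p` for `v = (p, q)`. -/
noncomputable def err (w₁ w₂ : ℝ) (x : EuclideanSpace ℝ (Fin 2)) (v : Vec) : ℝ :=
  max (|v.2.2 * x 0 - v.1| ^ w₁⁻¹) (|v.2.2 * x 1 - v.2.1| ^ w₂⁻¹)

theorem err_lt_iff {w₁ w₂ ρ : ℝ} (h₁ : 0 < w₁) (h₂ : 0 < w₂) (hρ : 0 ≤ ρ)
    {x : EuclideanSpace ℝ (Fin 2)} {v : Vec} : err w₁ w₂ x v < ρ ↔
      |v.2.2 * x 0 - v.1| < ρ ^ w₁ ∧ |v.2.2 * x 1 - v.2.1| < ρ ^ w₂ := by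
  rw [err, max_lt_iff, Real.rpow_inv_lt_iff_of_pos (abs_nonneg _) hρ h₁,
    Real.rpow_inv_lt_iff_of_pos (abs_nonneg _) hρ h₂]

/-- Points lying on no rational line. -/
def Generic (x : EuclideanSpace ℝ (Fin 2)) : Prop :=
  ∀ φ : Vec, φ ≠ 0 → (φ.1 : ℝ) * x 0 + φ.2.1 * x 1 + φ.2.2 ≠ 0

theorem Generic.err_pos {w₁ w₂ : ℝ} {x : EuclideanSpace ℝ (Fin 2)} (hx : Generic x) {v : Vec}
    (hv : 0 < v.2.2) : 0 < err w₁ w₂ x v := by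
  have h := hx (v.2.2, 0, -v.1) (fun h => hv.ne' (congrArg Prod.fst h))
  refine lt_max_of_lt_left (Real.rpow_pos_of_pos (abs_pos.2 fun h0 => h ?_) _)
  push_cast; linarith

theorem err_le_of_smul {w₁ w₂ : ℝ} (h₁ : 0 < w₁) (h₂ : 0 < w₂)
    {x : EuclideanSpace ℝ (Fin 2)} {v : Vec} {g : ℤ} (hg : 0 < g) :
    err w₁ w₂ x v ≤ err w₁ w₂ x (g • v) := by
  have key : ∀ t : ℝ, ∀ p q : ℤ, |q * t - p| ≤ |((g * q : ℤ) : ℝ) * t - (g * p : ℤ)| := by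
    intro t p q
    have : ((g * q : ℤ) : ℝ) * t - (g * p : ℤ) = g * (q * t - p) := by push_cast; ring
    rw [this, abs_mul]
    refine le_mul_of_one_le_left (abs_nonneg _) ?_
    exact_mod_cast Int.one_le_abs hg.ne'
  refine max_le_max ?_ ?_
  · exact Real.rpow_le_rpow (abs_nonneg _) (key _ _ _) (inv_nonneg.2 h₁.le)
  · exact Real.rpow_le_rpow (abs_nonneg _) (key _ _ _) (inv_nonneg.2 h₂.le)

/-- `u'` is the vector of smallest denominator approximating `x` better than `u`. -/
def IsNext (w₁ w₂ : ℝ) (x : EuclideanSpace ℝ (Fin 2)) (u u' : Vec) : Prop :=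
  0 < u'.2.2 ∧ err w₁ w₂ x u' < err w₁ w₂ x u ∧
    ∀ w : Vec, 0 < w.2.2 → err w₁ w₂ x w < err w₁ w₂ x u → u'.2.2 ≤ w.2.2

theorem exists_isNext {w₁ w₂ : ℝ} {x : EuclideanSpace ℝ (Fin 2)} {u w : Vec} (hw : 0 < w.2.2)
    (hwu : err w₁ w₂ x w < err w₁ w₂ x u) : ∃ u', IsNext w₁ w₂ x u u' := by
  classical
  have h : ∃ n : ℕ, ∃ u' : Vec, 0 < u'.2.2 ∧ err w₁ w₂ x u' < err w₁ w₂ x u ∧ u'.2.2 = n :=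
    ⟨w.2.2.toNat, w, hw, hwu, (Int.toNat_of_nonneg hw.le).symm⟩
  obtain ⟨u', h1, h2, h3⟩ := Nat.find_spec h
  refine ⟨u', h1, h2, fun z hz hzu => ?_⟩
  have := Nat.find_min' h ⟨z, hz, hzu, (Int.toNat_of_nonneg hz.le).symm⟩
  rw [h3]
  omega

theorem IsNext.prim {w₁ w₂ : ℝ} (h₁ : 0 < w₁) (h₂ : 0 < w₂) {x : EuclideanSpace ℝ (Fin 2)}
    {u u' : Vec} (h : IsNext w₁ w₂ x u u') : Prim u' := by
  obtain ⟨hq, herr, hmin⟩ := h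
  have hne : u' ≠ 0 := fun h0 => by simp [h0] at hq
  obtain ⟨g, hg, φ, hφ, rfl⟩ := exists_prim_smul hne
  have hqφ : 0 < φ.2.2 := by
    simp only [Prod.smul_snd, smul_eq_mul] at hq
    exact pos_of_mul_pos_right hq hg.le
  have h1 := hmin φ hqφ ((err_le_of_smul h₁ h₂ hg).trans_lt herr)
  simp only [Prod.smul_snd, smul_eq_mul] at h1
  have : g = 1 := by nlinarith
  rwa [this, one_smul]

theorem IsNext.lt {w₁ w₂ ρ : ℝ} (h₁ : 0 < w₁) (h₂ : 0 < w₂) {x : EuclideanSpace ℝ (Fin 2)}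
    {u u' u'' : Vec} (h : IsNext w₁ w₂ x u u') (h' : IsNext w₁ w₂ x u' u'') (hρ : 0 ≤ ρ)
    (hρ₁ : ρ ^ w₁ ≤ 1 / 2) (hρ₂ : ρ ^ w₂ ≤ 1 / 2) (hu : err w₁ w₂ x u ≤ ρ) :
    u'.2.2 < u''.2.2 := by
  refine lt_of_le_of_ne (h.2.2 u'' h'.1 (h'.2.1.trans h.2.1)) fun heq => ?_
  have a := (err_lt_iff h₁ h₂ hρ).1 (h.2.1.trans_le hu)
  have b := (err_lt_iff h₁ h₂ hρ).1 ((h'.2.1.trans h.2.1).trans_le hu)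
  have key : ∀ (t : ℝ) (q p p' : ℤ), |q * t - p| < 1 / 2 → |q * t - p'| < 1 / 2 → p = p' := by
    intro t q p p' h h'
    have : |((p - p' : ℤ) : ℝ)| < 1 := by
      rw [abs_lt] at *; push_cast; constructor <;> linarith
    have : |p - p'| < 1 := by exact_mod_cast this
    rw [Int.abs_lt_one_iff] at this
    omega
  have e : u' = u'' := by
    rw [← heq] at b
    ext
    · exact key _ _ _ _ (a.1.trans_le hρ₁) (b.1.trans_le hρ₁)
    · exact key _ _ _ _ (a.2.trans_le hρ₂) (b.2.trans_le hρ₂)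
    · exact heq
  have := h'.2.1
  rw [e] at this
  exact lt_irrefl _ this

/-- A sequence of primitive vectors of increasing denominators, each of which approximates `x`
well relative to the next denominator. -/
structure IsApprox (w₁ w₂ ε : ℝ) (x : EuclideanSpace ℝ (Fin 2)) (u : ℕ → Vec) : Prop where
  pos : ∀ k, 0 < (u k).2.2
  lt : ∀ k, (u k).2.2 < (u (k + 1)).2.2
  prim : ∀ k, Prim (u k)
  fst : ∀ k, |(u k).2.2 * x 0 - (u k).1| ≤ (ε / (u (k + 1)).2.2) ^ w₁
  snd : ∀ k, |(u k).2.2 * x 1 - (u k).2.1| ≤ (ε / (u (k + 1)).2.2) ^ w₂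

theorem exists_isApprox {w₁ w₂ ε : ℝ} (h₁ : 0 < w₁) (h₂ : 0 < w₂) (hε : 0 < ε)
    (hε₁ : ε ^ w₁ ≤ 1 / 2) (hε₂ : ε ^ w₂ ≤ 1 / 2) {x : EuclideanSpace ℝ (Fin 2)}
    (hx : x ∈ Sing w₁ w₂) (hg : Generic x) : ∃ u, IsApprox w₁ w₂ ε x u := by
  obtain ⟨T₀, hT₀, hT⟩ := hx ε hε
  have hT' : ∀ T, T₀ < T → ∃ u : Vec, 0 < u.2.2 ∧ err w₁ w₂ x u < ε / T ∧ u.2.2 < T := by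
    intro T h
    have hT0 : 0 < T := by linarith
    obtain ⟨p₁, p₂, q, ha, hb, hq, hqT⟩ := hT T h
    refine ⟨(p₁, p₂, q), hq, ?_, hqT⟩
    rw [err_lt_iff h₁ h₂ (by positivity), Real.div_rpow hε.le hT0.le,
      Real.div_rpow hε.le hT0.le, div_eq_mul_inv, div_eq_mul_inv, ← Real.rpow_neg hT0.le,
      ← Real.rpow_neg hT0.le]
    exact ⟨ha, hb⟩
  let S := {u : Vec // 0 < u.2.2 ∧ err w₁ w₂ x u < ε / T₀}
  have hnext : ∀ u : S, ∃ u' : S, IsNext w₁ w₂ x u u' ∧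
      (u'.1.2.2 : ℝ) * err w₁ w₂ x u < ε := by
    rintro ⟨u, hu, herr⟩
    have hpos : 0 < err w₁ w₂ x u := hg.err_pos hu
    have hlt : T₀ < ε / err w₁ w₂ x u := by
      rw [lt_div_iff₀ hpos, mul_comm]
      rwa [lt_div_iff₀ (by linarith)] at herr
    obtain ⟨w, hw, hwe, hwq⟩ := hT' _ hlt
    rw [div_div_cancel₀ hε.ne'] at hwe
    obtain ⟨u', hu'⟩ := exists_isNext hw hwe
    refine ⟨⟨u', hu'.1, hu'.2.1.trans herr⟩, hu', ?_⟩
    rw [← lt_div_iff₀ hpos]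
    refine lt_of_le_of_lt ?_ hwq
    exact_mod_cast hu'.2.2 w hw hwe
  choose next hnext hnext' using hnext
  obtain ⟨u₀, hu₀, hu₀e, -⟩ := hT' (T₀ + 1) (by linarith)
  let u₀' : S := ⟨u₀, hu₀, hu₀e.trans_le (by gcongr; linarith)⟩
  let c : ℕ → S := fun n => next^[n] u₀'
  have hc : ∀ n, c (n + 1) = next (c n) := fun n => Function.iterate_succ_apply' ..
  have hcn : ∀ n, IsNext w₁ w₂ x (c n) (c (n + 1)) := fun n => by rw [hc]; exact hnext _
  have hce : ∀ n, err w₁ w₂ x (c n).1 < ε / (c (n + 1)).1.2.2 := fun n => by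
    have hq : (0 : ℝ) < (c (n + 1)).1.2.2 := by exact_mod_cast (c (n + 1)).2.1
    rw [lt_div_iff₀ hq, mul_comm, hc]
    exact hnext' _
  have hqpos : ∀ n, (0 : ℝ) < (c n).1.2.2 := fun n => by exact_mod_cast (c n).2.1
  have happ : ∀ n, |((c n).1.2.2 : ℝ) * x 0 - (c n).1.1| < (ε / (c (n + 1)).1.2.2) ^ w₁ ∧
      |((c n).1.2.2 : ℝ) * x 1 - (c n).1.2.1| < (ε / (c (n + 1)).1.2.2) ^ w₂ := fun n =>
    (err_lt_iff h₁ h₂ (div_nonneg hε.le (hqpos _).le)).1 (hce n)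
  refine ⟨fun n => (c (n + 1)).1, fun k => (c _).2.1, fun k => ?_, fun k => (hcn k).prim h₁ h₂,
    fun k => (happ _).1.le, fun k => (happ _).2.le⟩
  refine (hcn k).lt h₁ h₂ (hcn (k + 1)) hε.le hε₁ hε₂ ((c k).2.2.le.trans ?_)
  exact div_le_self hε.le hT₀.le

section Approx

variable {w₁ w₂ ε : ℝ} {x : EuclideanSpace ℝ (Fin 2)} {u : ℕ → Vec}

theorem IsApprox.strictMono (h : IsApprox w₁ w₂ ε x u) : StrictMono fun k => (u k).2.2 :=
  strictMono_nat_of_lt_succ h.lt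

theorem IsApprox.pos_real (h : IsApprox w₁ w₂ ε x u) (k : ℕ) : (0 : ℝ) < (u k).2.2 := by
  exact_mod_cast h.pos k

theorem abs_cross_le {q q' p p' t B : ℝ} (hq : 0 ≤ q) (hqq' : q ≤ q') (h : |q * t - p| ≤ B)
    (h' : |q' * t - p'| ≤ B) : |q * p' - p * q'| ≤ 2 * q' * B := by
  have e : q * p' - p * q' = q' * (q * t - p) - q * (q' * t - p') := by ring
  have hB : 0 ≤ B := (abs_nonneg _).trans h
  rw [e]
  refine (abs_sub _ _).trans ?_
  rw [abs_mul, abs_mul, abs_of_nonneg hq, abs_of_nonneg (hq.trans hqq')]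
  nlinarith [abs_nonneg (q' * t - p'), abs_nonneg (q * t - p)]

theorem IsApprox.cross_fst (h : IsApprox w₁ w₂ ε x u) (h₁ : 0 ≤ w₁) (hε : 0 ≤ ε) {i l : ℕ}
    (hil : i < l) : |((u i).2.2 : ℝ) * (u l).1 - (u i).1 * (u l).2.2| ≤
      2 * (u l).2.2 * (ε / (u (i + 1)).2.2) ^ w₁ := by
  have hi := h.pos_real (i + 1)
  refine abs_cross_le (h.pos_real i).le (by exact_mod_cast (h.strictMono hil).le) (h.fst i)
    ((h.fst l).trans ?_)
  have : ((u (i + 1)).2.2 : ℝ) ≤ (u (l + 1)).2.2 := by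
    exact_mod_cast h.strictMono.monotone (by omega : i + 1 ≤ l + 1)
  have := h.pos_real (l + 1)
  gcongr

theorem IsApprox.cross_snd (h : IsApprox w₁ w₂ ε x u) (h₂ : 0 ≤ w₂) (hε : 0 ≤ ε) {i l : ℕ}
    (hil : i < l) : |((u i).2.2 : ℝ) * (u l).2.1 - (u i).2.1 * (u l).2.2| ≤
      2 * (u l).2.2 * (ε / (u (i + 1)).2.2) ^ w₂ := by
  have hi := h.pos_real (i + 1)
  refine abs_cross_le (h.pos_real i).le (by exact_mod_cast (h.strictMono hil).le) (h.snd i)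
    ((h.snd l).trans ?_)
  have : ((u (i + 1)).2.2 : ℝ) ≤ (u (l + 1)).2.2 := by
    exact_mod_cast h.strictMono.monotone (by omega : i + 1 ≤ l + 1)
  have := h.pos_real (l + 1)
  gcongr

/-- The approximations leave a rational line at index `n + 1`. -/
def Turn (u : ℕ → Vec) (n : ℕ) : Prop := dot (cross (u n) (u (n + 1))) (u (n + 2)) ≠ 0

theorem IsApprox.cross_succ_ne_zero (h : IsApprox w₁ w₂ ε x u) {i l : ℕ} (hil : i < l) :
    cross (u i) (u l) ≠ 0 :=
  cross_ne_zero (h.prim i) (h.prim l) (h.pos i) (h.strictMono hil)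

/-- Between two turns the approximations stay on one rational line. -/
theorem IsApprox.dot_eq_zero (h : IsApprox w₁ w₂ ε x u) {φ : Vec} {n : ℕ}
    (h0 : dot φ (u n) = 0) (h1 : dot φ (u (n + 1)) = 0) (i : ℕ)
    (ht : ∀ j, n ≤ j → j < n + i → ¬ Turn u j) :
    dot φ (u (n + i)) = 0 ∧ dot φ (u (n + i + 1)) = 0 := by
  induction i with
  | zero => exact ⟨h0, h1⟩
  | succ i ih =>
    obtain ⟨a, b⟩ := ih fun j hj hji => ht j hj (by omega)
    refine ⟨b, ?_⟩
    exact dot_eq_zero_of_cross (h.cross_succ_ne_zero (Nat.lt_succ_self (n + i)))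
      (cross_cross_eq_zero a b) (not_not.1 (ht (n + i) (by omega) (by omega)))

theorem IsApprox.exists_turn (h : IsApprox w₁ w₂ ε x u) (h₁ : 0 ≤ w₁) (h₂ : 0 ≤ w₂)
    (hε : 0 ≤ ε) (hε' : ε ≤ 1) (hg : Generic x) (K : ℕ) : ∃ n, K ≤ n ∧ Turn u n := by
  by_contra! hcon
  set φ := cross (u K) (u (K + 1)) with hφ
  have hφ0 : φ ≠ 0 := h.cross_succ_ne_zero (Nat.lt_succ_self K)
  have hdot : ∀ i, dot φ (u (K + i)) = 0 := fun i =>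
    (h.dot_eq_zero (dot_cross_left _ _) (dot_cross_right _ _) i fun j hj _ => hcon j hj).1
  apply hg φ hφ0
  set c := (φ.1 : ℝ) * x 0 + φ.2.1 * x 1 + φ.2.2 with hc
  have hbase : ∀ k, 0 ≤ ε / (u k).2.2 ∧ ε / (u k).2.2 ≤ 1 := fun k => by
    have h1 : (1 : ℝ) ≤ (u k).2.2 := by exact_mod_cast h.pos k
    exact ⟨div_nonneg hε (h.pos_real k).le, (div_le_one (h.pos_real k)).2 (hε'.trans h1)⟩
  have hbound : ∀ i : ℕ, (i : ℝ) * |c| ≤ |(φ.1 : ℝ)| + |(φ.2.1 : ℝ)| := by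
    intro i
    have hq : (i : ℝ) ≤ (u (K + i)).2.2 := by
      have h1 : ∀ i : ℕ, (i : ℤ) ≤ (u (K + i)).2.2 := by
        intro i
        induction i with
        | zero => exact (h.pos _).le
        | succ i ih => have := h.lt (K + i); rw [← add_assoc]; push_cast; omega
      exact_mod_cast h1 i
    have hd : (φ.1 : ℝ) * (u (K + i)).1 + φ.2.1 * (u (K + i)).2.1 +
        φ.2.2 * (u (K + i)).2.2 = 0 := by exact_mod_cast hdot i
    have e : (u (K + i)).2.2 * c = φ.1 * ((u (K + i)).2.2 * x 0 - (u (K + i)).1) +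
        φ.2.1 * ((u (K + i)).2.2 * x 1 - (u (K + i)).2.1) := by
      rw [hc]; linear_combination hd
    have b1 := (h.fst (K + i)).trans
      (Real.rpow_le_one (hbase (K + i + 1)).1 (hbase (K + i + 1)).2 h₁)
    have b2 := (h.snd (K + i)).trans
      (Real.rpow_le_one (hbase (K + i + 1)).1 (hbase (K + i + 1)).2 h₂)
    calc (i : ℝ) * |c| ≤ (u (K + i)).2.2 * |c| := by gcongr
      _ = |(u (K + i)).2.2 * c| := by rw [abs_mul, abs_of_pos (h.pos_real _)]
      _ ≤ _ := by
        rw [e]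
        refine (abs_add_le _ _).trans ?_
        rw [abs_mul, abs_mul]
        exact add_le_add (mul_le_of_le_one_right (abs_nonneg _) b1)
          (mul_le_of_le_one_right (abs_nonneg _) b2)
  by_contra hne
  obtain ⟨n, hn⟩ := exists_nat_gt ((|(φ.1 : ℝ)| + |(φ.2.1 : ℝ)|) / |c|)
  rw [div_lt_iff₀ (abs_pos.2 hne)] at hn
  exact absurd (hbound n) (not_le.2 hn)

/-- The scale at which the form with leading coefficients `a, b` becomes visible. -/
noncomputable def scale (w₁ w₂ ε a b : ℝ) : ℝ :=
  max ((|a| / (2 * ε ^ w₂)) ^ w₁⁻¹) ((|b| / (2 * ε ^ w₁)) ^ w₂⁻¹)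

section Scale

variable {a b : ℝ}

theorem scale_le_iff (h₁ : 0 < w₁) (h₂ : 0 < w₂) (hε : 0 < ε) {X : ℝ} (hX : 0 ≤ X) :
    scale w₁ w₂ ε a b ≤ X ↔ |a| ≤ 2 * ε ^ w₂ * X ^ w₁ ∧ |b| ≤ 2 * ε ^ w₁ * X ^ w₂ := by
  rw [scale, max_le_iff, Real.rpow_inv_le_iff_of_pos (by positivity) hX h₁,
    Real.rpow_inv_le_iff_of_pos (by positivity) hX h₂, div_le_iff₀ (by positivity),
    div_le_iff₀ (by positivity), mul_comm, mul_comm (X ^ w₂)]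

theorem scale_eq (h₁ : 0 < w₁) (h₂ : 0 < w₂) (hε : 0 < ε) :
    |a| = 2 * ε ^ w₂ * scale w₁ w₂ ε a b ^ w₁ ∨ |b| = 2 * ε ^ w₁ * scale w₁ w₂ ε a b ^ w₂ := by
  rcases max_choice ((|a| / (2 * ε ^ w₂)) ^ w₁⁻¹) ((|b| / (2 * ε ^ w₁)) ^ w₂⁻¹) with h | h
  · left
    rw [scale, h, Real.rpow_inv_rpow (by positivity) h₁.ne']
    field_simp
  · right
    rw [scale, h, Real.rpow_inv_rpow (by positivity) h₂.ne']
    field_simp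

theorem mul_scale_le (h₁ : 0 < w₁) (h₂ : 0 < w₂) (hsum : w₁ + w₂ = 1) (hε : 0 < ε)
    {j q Q : ℝ} (hR : 0 < scale w₁ w₂ ε a b) (hRQ : scale w₁ w₂ ε a b ≤ Q)
    (hq : 0 ≤ q)
    (ha : j * |a| ≤ 2 * q * (ε / Q) ^ w₂) (hb : j * |b| ≤ 2 * q * (ε / Q) ^ w₁) :
    j * scale w₁ w₂ ε a b ≤ q := by
  have key : ∀ s t : ℝ, 0 < s → 0 < t → t + s = 1 →
      j * (2 * ε ^ t * scale w₁ w₂ ε a b ^ s) ≤ 2 * q * (ε / Q) ^ t →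
      j * scale w₁ w₂ ε a b ≤ q := by
    intro s t hs ht hst h
    generalize scale w₁ w₂ ε a b = R at *
    have hQ : 0 < Q := hR.trans_le hRQ
    have h1 : 2 * q * (ε / Q) ^ t ≤ 2 * q * (ε / R) ^ t := by gcongr
    have h2 := h.trans h1
    rw [Real.div_rpow hε.le hR.le] at h2
    have hRt : 0 < R ^ t := by positivity
    have hεt : 0 < ε ^ t := by positivity
    have e : R = R ^ t * R ^ s := by rw [← Real.rpow_add hR, hst, Real.rpow_one]
    have h3 : j * (2 * ε ^ t * R ^ s) * R ^ t ≤ 2 * q * ε ^ t := by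
      rwa [← mul_div_assoc, le_div_iff₀ hRt] at h2
    rw [e]
    have h4 : (2 * ε ^ t) * (j * (R ^ t * R ^ s)) ≤ (2 * ε ^ t) * q := by linarith
    exact le_of_mul_le_mul_left h4 (by positivity)
  rcases scale_eq (a := a) (b := b) h₁ h₂ hε with h | h
  · rw [h] at ha; exact key w₁ w₂ h₁ h₂ (by linarith) ha
  · rw [h] at hb; exact key w₂ w₁ h₂ h₁ (by linarith) hb

theorem le_scale_of_one_le (h₁ : 0 < w₁) (h₂ : 0 < w₂) (hsum : w₁ + w₂ = 1) (hε : 0 < ε)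
    (hε' : ε ≤ 1 / 16) {q : ℝ} (hq : 0 < q)
    (h : 1 ≤ 2 * (|a| * (ε / q) ^ w₁ + |b| * (ε / q) ^ w₂)) :
    q / (8 * ε) ≤ scale w₁ w₂ ε a b := by
  by_contra! hlt
  have hX : 0 < q / (8 * ε) := by positivity
  obtain ⟨ha, hb⟩ := (scale_le_iff h₁ h₂ hε hX.le).1 hlt.le
  have e : ∀ s t : ℝ, s + t = 1 →
      ε ^ t * (q / (8 * ε)) ^ s * (ε / q) ^ s = ε * (1 / (8 * ε)) ^ s := by
    intro s t hst
    have h1 : ε ^ t * ε ^ s = ε := by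
      rw [← Real.rpow_add hε, add_comm, hst, Real.rpow_one]
    have h2 : (q / (8 * ε)) ^ s * (ε / q) ^ s = ε ^ s * (1 / (8 * ε)) ^ s := by
      rw [← Real.mul_rpow (by positivity) (by positivity),
        ← Real.mul_rpow (by positivity) (by positivity)]
      congr 1; field_simp
    rw [mul_assoc, h2, ← mul_assoc, h1]
  have hbig : 1 < 1 / (8 * ε) := by rw [lt_div_iff₀ (by positivity)]; linarith
  have hp : ∀ s : ℝ, s < 1 → (1 / (8 * ε)) ^ s < 1 / (8 * ε) := by
    intro s hs
    have := Real.rpow_lt_rpow_of_exponent_lt hbig hs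
    rwa [Real.rpow_one] at this
  have f1 : |a| * (ε / q) ^ w₁ ≤ 2 * (ε * (1 / (8 * ε)) ^ w₁) := by
    rw [← e w₁ w₂ hsum]
    have := mul_le_mul_of_nonneg_right ha (by positivity : 0 ≤ (ε / q) ^ w₁)
    linarith
  have f2 : |b| * (ε / q) ^ w₂ ≤ 2 * (ε * (1 / (8 * ε)) ^ w₂) := by
    rw [← e w₂ w₁ (by linarith)]
    have := mul_le_mul_of_nonneg_right hb (by positivity : 0 ≤ (ε / q) ^ w₂)
    linarith
  have g1 := mul_lt_mul_of_pos_left (hp w₁ (by linarith)) hε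
  have g2 := mul_lt_mul_of_pos_left (hp w₂ (by linarith)) hε
  have g3 : ε * (1 / (8 * ε)) = 1 / 8 := by field_simp
  linarith

end Scale

theorem IsApprox.step (h : IsApprox w₁ w₂ ε x u) (h₁ : 0 < w₁) (h₂ : 0 < w₂)
    (hsum : w₁ + w₂ = 1) (hε : 0 < ε) (hε' : ε ≤ 1 / 16) {n m : ℕ} (hnm : n < m)
    (hn : Turn u n) (hbetween : ∀ j, n < j → j < m → ¬ Turn u j) :
    Step w₁ w₂ ε (u (n + 1)) (u (m + 1)) := by
  have hQpos := h.pos_real (n + 2)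
  have hqpos := h.pos_real (n + 1)
  have hq'pos := h.pos_real (m + 1)
  obtain ⟨g, hg, φ, hφ, hφg⟩ :=
    exists_prim_smul (h.cross_succ_ne_zero (Nat.lt_succ_self (n + 1)))
  have hdot : ∀ z, dot (cross (u (n + 1)) (u (n + 2))) z = 0 → dot φ z = 0 := by
    intro z hz
    rw [hφg, dot_smul_left] at hz
    exact (mul_eq_zero.1 hz).resolve_left hg.ne'
  have hφv : dot φ (u (n + 1)) = 0 := hdot _ (dot_cross_left _ _)
  have hφv' : dot φ (u (m + 1)) = 0 := by
    have := (h.dot_eq_zero hφv (hdot _ (dot_cross_right _ _)) (m - n - 1)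
      fun j hj hj' => hbetween j (by omega) (by omega)).2
    rwa [show n + 1 + (m - n - 1) + 1 = m + 1 by omega] at this
  have hφa : dot φ (u n) ≠ 0 := by
    intro h0
    apply hn
    have : dot (cross (u (n + 1)) (u (n + 2))) (u n) = 0 := by
      rw [hφg, dot_smul_left, h0, mul_zero]
    rw [← this]; simp only [dot, cross]; ring
  obtain ⟨j, hj⟩ := hφ.exists_eq_smul (cross_cross_eq_zero hφv hφv')
  have hj0 : j ≠ 0 := by
    rintro rfl
    exact h.cross_succ_ne_zero (by omega : n + 1 < m + 1) (by rw [hj, zero_smul])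
  have hcomp : ∀ (i : ℤ) (l : ℕ), n + 1 < l → cross (u (n + 1)) (u l) = i • φ →
      |(i : ℝ)| * |(φ.1 : ℝ)| ≤ 2 * (u l).2.2 * (ε / (u (n + 2)).2.2) ^ w₂ ∧
      |(i : ℝ)| * |(φ.2.1 : ℝ)| ≤ 2 * (u l).2.2 * (ε / (u (n + 2)).2.2) ^ w₁ := by
    intro i l hl hi
    have e1 : (u (n + 1)).2.1 * (u l).2.2 - (u (n + 1)).2.2 * (u l).2.1 = i * φ.1 :=
      congrArg Prod.fst hi
    have e2 : (u (n + 1)).2.2 * (u l).1 - (u (n + 1)).1 * (u l).2.2 = i * φ.2.1 :=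
      congrArg (fun z : Vec => z.2.1) hi
    have f1 : (i : ℝ) * φ.1 =
        -((u (n + 1)).2.2 * (u l).2.1 - (u (n + 1)).2.1 * (u l).2.2) := by
      rw [neg_sub]; exact_mod_cast e1.symm
    have f2 : (i : ℝ) * φ.2.1 =
        (u (n + 1)).2.2 * (u l).1 - (u (n + 1)).1 * (u l).2.2 := by exact_mod_cast e2.symm
    rw [← abs_mul, ← abs_mul, f1, f2, abs_neg]
    exact ⟨h.cross_snd h₂.le hε.le hl, h.cross_fst h₁.le hε.le hl⟩
  set R := scale w₁ w₂ ε φ.1 φ.2.1 with hR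
  have hRQ : R ≤ (u (n + 2)).2.2 := by
    obtain ⟨c1, c2⟩ := hcomp g (n + 2) (by omega) hφg
    have hg1 : (1 : ℝ) ≤ |(g : ℝ)| := by exact_mod_cast Int.one_le_abs hg.ne'
    have e : ∀ s t : ℝ, s + t = 1 → 2 * ((u (n + 2)).2.2 : ℝ) * (ε / (u (n + 2)).2.2) ^ t =
        2 * ε ^ t * ((u (n + 2)).2.2 : ℝ) ^ s := by
      intro s t hst
      have : ((u (n + 2)).2.2 : ℝ) =
          ((u (n + 2)).2.2 : ℝ) ^ t * ((u (n + 2)).2.2 : ℝ) ^ s := by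
        rw [← Real.rpow_add hQpos, add_comm t, hst, Real.rpow_one]
      rw [Real.div_rpow hε.le hQpos.le]
      field_simp
      exact this
    rw [e w₁ w₂ hsum] at c1
    rw [e w₂ w₁ (by linarith)] at c2
    exact (scale_le_iff h₁ h₂ hε hQpos.le).2
      ⟨(le_mul_of_one_le_left (abs_nonneg _) hg1).trans c1,
        (le_mul_of_one_le_left (abs_nonneg _) hg1).trans c2⟩
  have hrR : ((u (n + 1)).2.2 : ℝ) / (8 * ε) ≤ R := by
    apply le_scale_of_one_le h₁ h₂ hsum hε hε' hqpos
    have d1 : (1 : ℝ) ≤ |((dot φ (u n) : ℤ) : ℝ)| := by exact_mod_cast Int.one_le_abs hφa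
    have hv : (φ.1 : ℝ) * (u (n + 1)).1 + φ.2.1 * (u (n + 1)).2.1 +
        φ.2.2 * (u (n + 1)).2.2 = 0 := by exact_mod_cast hφv
    have e : ((u (n + 1)).2.2 : ℝ) * ((dot φ (u n) : ℤ) : ℝ) =
        -(φ.1 * ((u n).2.2 * (u (n + 1)).1 - (u n).1 * (u (n + 1)).2.2) +
          φ.2.1 * ((u n).2.2 * (u (n + 1)).2.1 - (u n).2.1 * (u (n + 1)).2.2)) := by
      simp only [dot]; push_cast
      linear_combination ((u n).2.2 : ℝ) * hv
    have b1 := h.cross_fst h₁.le hε.le (Nat.lt_succ_self n)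
    have b2 := h.cross_snd h₂.le hε.le (Nat.lt_succ_self n)
    rw [Nat.succ_eq_add_one] at b1 b2
    have h3 : ((u (n + 1)).2.2 : ℝ) * 1 ≤ (u (n + 1)).2.2 *
        (2 * (|(φ.1 : ℝ)| * (ε / (u (n + 1)).2.2) ^ w₁ +
          |(φ.2.1 : ℝ)| * (ε / (u (n + 1)).2.2) ^ w₂)) := by
      calc _ ≤ ((u (n + 1)).2.2 : ℝ) * |((dot φ (u n) : ℤ) : ℝ)| := by gcongr
        _ = |((u (n + 1)).2.2 : ℝ) * ((dot φ (u n) : ℤ) : ℝ)| := by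
          rw [abs_mul, abs_of_pos hqpos]
        _ ≤ _ := by
          rw [e, abs_neg]
          refine (abs_add_le _ _).trans ?_
          rw [abs_mul, abs_mul]
          have := mul_le_mul_of_nonneg_left b1 (abs_nonneg (φ.1 : ℝ))
          have := mul_le_mul_of_nonneg_left b2 (abs_nonneg (φ.2.1 : ℝ))
          linarith
    exact le_of_mul_le_mul_left h3 hqpos
  have hr0 : 0 < ((u (n + 1)).2.2 : ℝ) / (8 * ε) := by positivity
  have hR0 : 0 < R := hr0.trans_le hrR
  have hjR : |(j : ℝ)| * R ≤ (u (m + 1)).2.2 := by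
    obtain ⟨c1, c2⟩ := hcomp j (m + 1) (by omega) hj
    exact mul_scale_le h₁ h₂ hsum hε hR0 hRQ hq'pos.le c1 c2
  obtain ⟨k, hk1, hk2⟩ := exists_nat_pow_near ((one_le_div hr0).2 hrR) one_lt_two
  rw [le_div_iff₀ hr0] at hk1
  rw [div_lt_iff₀ hr0] at hk2
  obtain ⟨s1, s2⟩ := (scale_le_iff h₁ h₂ hε (by positivity)).1 hk2.le
  refine ⟨h.prim _, h.pos _, k, φ, j, hj0, ⟨hφ, hφv, s1, s2⟩, hj, ?_⟩
  exact le_trans (by gcongr) hjR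

theorem abs_sub_div_le {t p q Q w : ℝ} (hq : 0 < q) (hqQ : q ≤ Q) (hw : 0 ≤ w) (hε : 0 ≤ ε)
    (hε' : ε ≤ 1) (h : |q * t - p| ≤ (ε / Q) ^ w) : |t - p / q| ≤ q ^ (-1 - w) := by
  have e : t - p / q = q⁻¹ * (q * t - p) := by field_simp
  rw [e, abs_mul, abs_of_pos (inv_pos.2 hq), show (-1 - w : ℝ) = -1 + -w by ring, Real.rpow_add hq,
    Real.rpow_neg_one, Real.rpow_neg hq.le, ← Real.inv_rpow hq.le]
  have hQ : 0 < Q := hq.trans_le hqQ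
  have : ε / Q ≤ q⁻¹ := by
    rw [← one_div]; gcongr
  have := h.trans (Real.rpow_le_rpow (by positivity) this hw)
  gcongr

theorem IsApprox.exists_mem_chainLimits (h : IsApprox w₁ w₂ ε x u) (h₁ : 0 < w₁) (h₂ : 0 < w₂)
    (hsum : w₁ + w₂ = 1) (hε : 0 < ε) (hε' : ε ≤ 1 / 16) (hg : Generic x) :
    ∃ v : Vec, 0 < v.2.2 ∧ x ∈ chainLimits w₁ w₂ ε v := by
  have hinf : (Set.ofPred (Turn u)).Infinite := by
    rw [Set.infinite_iff_exists_gt]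
    intro K
    obtain ⟨n, hn, ht⟩ := h.exists_turn h₁.le h₂.le hε.le (by linarith) hg (K + 1)
    exact ⟨n, ht, hn⟩
  refine ⟨u (Nat.nth (Turn u) 0 + 1), h.pos _, fun i => u (Nat.nth (Turn u) i + 1), rfl,
    fun i => ?_, fun i => ⟨?_, ?_⟩⟩
  · refine h.step h₁ h₂ hsum hε hε' (Nat.nth_strictMono hinf (Nat.lt_succ_self i))
      (Nat.nth_mem_of_infinite hinf i) fun j hj hj' ht => ?_
    exact absurd (Nat.le_nth_of_lt_nth_succ hj' ht) (not_le.2 hj)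
  · exact abs_sub_div_le (h.pos_real _) (by exact_mod_cast (h.lt _).le) h₁.le hε.le
      (by linarith) (h.fst _)
  · exact abs_sub_div_le (h.pos_real _) (by exact_mod_cast (h.lt _).le) h₂.le hε.le
      (by linarith) (h.snd _)

end Approx

theorem dimH_line_le_one {a b : ℝ} (c : ℝ) (hab : 0 < a * a + b * b) :
    dimH {x : EuclideanSpace ℝ (Fin 2) | a * x 0 + b * x 1 + c = 0} ≤ 1 := by
  rcases Set.eq_empty_or_nonempty {x : EuclideanSpace ℝ (Fin 2) | a * x 0 + b * x 1 + c = 0}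
    with h | ⟨y, hy⟩
  · simp [h]
  have hy : a * y 0 + b * y 1 + c = 0 := hy
  have hf : ContDiff ℝ 1 fun t : ℝ => y + t • !₂[b, -a] := by fun_prop
  have := hf.dimH_range_le
  rw [Module.finrank_self, Nat.cast_one] at this
  refine (dimH_mono ?_).trans this
  intro x hx
  have hx : a * x 0 + b * x 1 + c = 0 := hx
  have hS := hab.ne'
  refine ⟨(b * (x 0 - y 0) - a * (x 1 - y 1)) / (a * a + b * b), ?_⟩
  have ht := div_mul_cancel₀ (b * (x 0 - y 0) - a * (x 1 - y 1)) hS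
  generalize (b * (x 0 - y 0) - a * (x 1 - y 1)) / (a * a + b * b) = t at ht
  ext i
  fin_cases i
  · show y 0 + t * b = x 0
    refine mul_left_cancel₀ hS ?_
    linear_combination b * ht + a * (hy - hx)
  · show y 1 + t * -a = x 1
    refine mul_left_cancel₀ hS ?_
    linear_combination -a * ht + b * (hy - hx)

theorem dimH_not_generic_le : dimH {x | ¬ Generic x} ≤ 1 := by
  have hsub : {x | ¬ Generic x} ⊆ ⋃ φ ∈ {φ : Vec | φ ≠ 0},
      {x : EuclideanSpace ℝ (Fin 2) | (φ.1 : ℝ) * x 0 + φ.2.1 * x 1 + φ.2.2 = 0} := by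
    intro x hx
    have hx : ¬ Generic x := hx
    unfold Generic at hx
    push Not at hx
    obtain ⟨φ, hφ, h⟩ := hx
    exact Set.mem_biUnion hφ h
  refine (dimH_mono hsub).trans ?_
  rw [dimH_bUnion (Set.to_countable _)]
  refine iSup₂_le fun φ hφ => ?_
  by_cases hab : 0 < (φ.1 : ℝ) * φ.1 + φ.2.1 * φ.2.1
  · exact dimH_line_le_one _ hab
  · have h1 : (φ.1 : ℝ) = 0 := by nlinarith [mul_self_nonneg (φ.1 : ℝ), mul_self_nonneg (φ.2.1 : ℝ)]
    have h2 : (φ.2.1 : ℝ) = 0 := by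
      nlinarith [mul_self_nonneg (φ.1 : ℝ), mul_self_nonneg (φ.2.1 : ℝ)]
    have h3 : (φ.2.2 : ℝ) ≠ 0 := fun h3 => hφ
      (Prod.ext (by exact_mod_cast h1) (Prod.ext (by exact_mod_cast h2) (by exact_mod_cast h3)))
    simp [h1, h2, h3]

theorem exists_pos_forall_tsum_step_le {w₁ w₂ δ : ℝ} (hw₂ : 0 < w₂) (hw : w₂ ≤ w₁)
    (hsum : w₁ + w₂ = 1) (hδ : 0 < δ) :
    ∃ ε, 0 < ε ∧ ε ≤ 1 / 16 ∧ ε ^ w₁ ≤ 1 / 2 ∧ ε ^ w₂ ≤ 1 / 2 ∧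
      ∀ v, ∑' u : {u | Step w₁ w₂ ε v u}, wt δ u ≤ 2⁻¹ * wt δ v := by
  obtain ⟨ε₀, h₀, h⟩ := exists_tsum_step_le (w₁ := w₁) (w₂ := w₂) hsum hδ
  have hp : 0 < (1 / 2 : ℝ) ^ w₂⁻¹ := by positivity
  set ε := min ε₀ (min (1 / 16) ((1 / 2 : ℝ) ^ w₂⁻¹))
  have hε : 0 < ε := lt_min h₀ (lt_min (by norm_num) hp)
  have hε16 : ε ≤ 1 / 16 := (min_le_right _ _).trans (min_le_left _ _)
  have h2 : ε ^ w₂ ≤ 1 / 2 := by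
    have := Real.rpow_le_rpow hε.le ((min_le_right _ _).trans (min_le_right _ _)) hw₂.le
    rwa [Real.rpow_inv_rpow (by norm_num) hw₂.ne'] at this
  exact ⟨ε, hε, hε16, (Real.rpow_le_rpow_of_exponent_ge hε (by linarith) hw).trans h2, h2,
    h ε hε (min_le_left _ _)⟩

theorem dimH_sing_le {w₁ w₂ s : ℝ} (hw₂ : 0 < w₂) (hw : w₂ ≤ w₁) (hsum : w₁ + w₂ = 1)
    (hs : 2 - 1 / (1 + w₁) < s) : dimH (Sing w₁ w₂) ≤ ENNReal.ofReal s := by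
  have h₁ : 0 < w₁ := hw₂.trans_le hw
  have hinv : 1 / (1 + w₁) ≤ 1 := by rw [div_le_one (by linarith)]; linarith
  have hδ : 0 < (1 + w₁) * s - (2 + w₁ - w₂) := by
    have h := mul_lt_mul_of_pos_left hs (by linarith : 0 < 1 + w₁)
    rw [mul_sub, mul_one_div_cancel (by linarith)] at h
    linarith
  obtain ⟨ε, hε, hε', hε₁, hε₂, h⟩ := exists_pos_forall_tsum_step_le hw₂ hw hsum hδ
  have hsub : Sing w₁ w₂ ⊆ {x | ¬ Generic x} ∪
      ⋃ v ∈ {v : Vec | 0 < v.2.2}, chainLimits w₁ w₂ ε v := by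
    intro x hx
    by_cases hg : Generic x
    · obtain ⟨u, hu⟩ := exists_isApprox h₁ hw₂ hε hε₁ hε₂ hx hg
      obtain ⟨v, hv, hxv⟩ := hu.exists_mem_chainLimits h₁ hw₂ hsum hε hε' hg
      exact Or.inr (Set.mem_biUnion hv hxv)
    · exact Or.inl hg
  refine (dimH_mono hsub).trans ?_
  rw [dimH_union, dimH_bUnion (Set.to_countable _)]
  refine max_le (dimH_not_generic_le.trans ?_) (iSup₂_le fun v hv =>
    dimH_chainLimits_le hw₂ hw (by linarith) (by ring) hε hε' h hv)
  rw [ENNReal.one_le_ofReal]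
  linarith

end WeightedSingular

/-- Both `Sing(w)* = {x ∈ Sing(w) : 1, x₁, x₂ are ℚ-linearly independent}` and
`Sing(w)` have Hausdorff dimension at most `2 - 1/(1+w₁)`. -/
theorem dimH_sing_upper_bound (w₁ w₂ : ℝ) (hw₂ : 0 < w₂) (hw : w₂ ≤ w₁)
    (hsum : w₁ + w₂ = 1) :
    dimH {x ∈ Sing w₁ w₂ | LinearIndependent ℚ ![(1 : ℝ), x 0, x 1]} ≤
        ENNReal.ofReal (2 - 1 / (1 + w₁)) ∧
      dimH (Sing w₁ w₂) ≤ ENNReal.ofReal (2 - 1 / (1 + w₁)) := by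
  have h : dimH (Sing w₁ w₂) ≤ ENNReal.ofReal (2 - 1 / (1 + w₁)) := by
    refine ENNReal.le_of_forall_pos_le_add fun η hη _ => ?_
    refine (WeightedSingular.dimH_sing_le hw₂ hw hsum
      (lt_add_of_pos_right _ (NNReal.coe_pos.2 hη))).trans ?_
    exact ENNReal.ofReal_add_le.trans_eq (by rw [ENNReal.ofReal_coe_nnreal])
  exact ⟨(dimH_mono fun _ hx => hx.1).trans h, h⟩
end
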